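/- arXiv:2408.03141 — 2 statements merged into one kernel-verified Lean document; each statement's English description precedes it below -/
import Mathlib

section
/- Let Γ be a groupoid and R an object unital Γ-graded ring. Then R is a gr-simple ring that is right Γ₀-artinian if and only if there exist e₀ ∈ Γ₀, a Γ-graded division ring D with supp(D) ⊆ e₀Γe₀, a nonempty set I and a d-finite sequence σ̄ = (σ_i)_{i∈I} of elements of e₀Γ such that R ≅_gr M_I(D)(σ̄). -/
set_option autoImplicit false

noncomputable section

universe u v w x y

/-- A groupoid structure on its set `Γ` of morphisms.  Objects are identified with
the identity morphisms: `src γ` and `tgt γ` are the source and target identities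
(`d(γ)` and `r(γ)`), and `comp γ δ h` is the composite `γδ`, which is defined
exactly when `src γ = tgt δ`. -/
structure Gpd (Γ : Type u) where
  src : Γ → Γ
  tgt : Γ → Γ
  inv : Γ → Γ
  comp : (γ δ : Γ) → src γ = tgt δ → Γ
  src_src : ∀ γ, src (src γ) = src γ
  tgt_src : ∀ γ, tgt (src γ) = src γ
  src_tgt : ∀ γ, src (tgt γ) = tgt γ
  tgt_tgt : ∀ γ, tgt (tgt γ) = tgt γ
  src_comp : ∀ γ δ (h : src γ = tgt δ), src (comp γ δ h) = src δ
  tgt_comp : ∀ γ δ (h : src γ = tgt δ), tgt (comp γ δ h) = tgt γ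
  comp_id : ∀ γ, comp γ (src γ) (tgt_src γ).symm = γ
  id_comp : ∀ γ, comp (tgt γ) γ (src_tgt γ) = γ
  comp_assoc : ∀ γ δ ε (h₁ : src γ = tgt δ) (h₂ : src δ = tgt ε),
    comp (comp γ δ h₁) ε ((src_comp γ δ h₁).trans h₂)
      = comp γ (comp δ ε h₂) (h₁.trans (tgt_comp δ ε h₂).symm)
  src_inv : ∀ γ, src (inv γ) = tgt γ
  tgt_inv : ∀ γ, tgt (inv γ) = src γ
  inv_inv : ∀ γ, inv (inv γ) = γ
  comp_inv : ∀ γ, comp γ (inv γ) (tgt_inv γ).symm = tgt γ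
  inv_comp : ∀ γ, comp (inv γ) γ (src_inv γ) = src γ

namespace Gpd

variable {Γ : Type u} (G : Gpd Γ)

/-- `e` is an object of the groupoid, i.e. an identity morphism. -/
def IsObj (e : Γ) : Prop := G.src e = e

open scoped Classical in
/-- Partial composition: `some (γδ)` when defined, `none` otherwise. -/
def mul? (γ δ : Γ) : Option Γ :=
  if h : G.src γ = G.tgt δ then some (G.comp γ δ h) else none

/-- The partial triple product `σ γ τ⁻¹`, `none` when undefined. -/
def conj? (σ γ τ : Γ) : Option Γ :=
  (G.mul? σ γ).bind fun η => G.mul? η (G.inv τ)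

end Gpd

/-- An object unital `Γ`-graded ring structure on the (possibly non-unital) ring `R`:
a decomposition `R = ⊕ R_γ` with `R_γ R_δ ⊆ R_{γδ}` (zero when `γδ` is undefined),
together with local units `1_e ∈ R_e` for the objects `e` such that
`1_{r(γ)} a = a 1_{d(γ)} = a` for homogeneous `a` of degree `γ`. -/
structure GammaRing {Γ : Type u} (G : Gpd Γ) (R : Type v) [NonUnitalRing R] where
  grade : Γ → AddSubgroup R
  grade_iSup : (⨆ γ : Γ, grade γ) = ⊤
  grade_indep : ∀ γ : Γ, grade γ ⊓ (⨆ (δ : Γ) (_ : δ ≠ γ), grade δ) = ⊥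
  mul_mem : ∀ (γ δ : Γ) (h : G.src γ = G.tgt δ) (a b : R),
    a ∈ grade γ → b ∈ grade δ → a * b ∈ grade (G.comp γ δ h)
  mul_ne : ∀ (γ δ : Γ), G.src γ ≠ G.tgt δ → ∀ (a b : R),
    a ∈ grade γ → b ∈ grade δ → a * b = 0
  one : Γ → R
  one_mem : ∀ e : Γ, G.IsObj e → one e ∈ grade e
  one_mul' : ∀ (γ : Γ) (a : R), a ∈ grade γ → one (G.tgt γ) * a = a
  mul_one' : ∀ (γ : Γ) (a : R), a ∈ grade γ → a * one (G.src γ) = a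

/-- A (unital) `Γ`-graded right module over the object unital `Γ`-graded ring `RG`. -/
structure GammaMod {Γ : Type u} {G : Gpd Γ} {R : Type v} [NonUnitalRing R]
    (RG : GammaRing G R) (M : Type w) [AddCommGroup M] where
  smul : M → R → M
  smul_add : ∀ (m : M) (a b : R), smul m (a + b) = smul m a + smul m b
  add_smul : ∀ (m n : M) (a : R), smul (m + n) a = smul m a + smul n a
  smul_mul : ∀ (m : M) (a b : R), smul m (a * b) = smul (smul m a) b
  grade : Γ → AddSubgroup M
  grade_iSup : (⨆ γ : Γ, grade γ) = ⊤
  grade_indep : ∀ γ : Γ, grade γ ⊓ (⨆ (δ : Γ) (_ : δ ≠ γ), grade δ) = ⊥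
  smul_mem : ∀ (σ τ : Γ) (h : G.src σ = G.tgt τ) (m : M) (a : R),
    m ∈ grade σ → a ∈ RG.grade τ → smul m a ∈ grade (G.comp σ τ h)
  smul_ne : ∀ (σ τ : Γ), G.src σ ≠ G.tgt τ → ∀ (m : M) (a : R),
    m ∈ grade σ → a ∈ RG.grade τ → smul m a = 0
  smul_one : ∀ (σ : Γ) (m : M), m ∈ grade σ → smul m (RG.one (G.src σ)) = m

/-- A (unital) `Γ`-graded left module over the object unital `Γ`-graded ring `RG`. -/
structure GammaLMod {Γ : Type u} {G : Gpd Γ} {R : Type v} [NonUnitalRing R]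
    (RG : GammaRing G R) (M : Type w) [AddCommGroup M] where
  smul : R → M → M
  smul_add : ∀ (a : R) (m n : M), smul a (m + n) = smul a m + smul a n
  add_smul : ∀ (a b : R) (m : M), smul (a + b) m = smul a m + smul b m
  mul_smul : ∀ (a b : R) (m : M), smul (a * b) m = smul a (smul b m)
  grade : Γ → AddSubgroup M
  grade_iSup : (⨆ γ : Γ, grade γ) = ⊤
  grade_indep : ∀ γ : Γ, grade γ ⊓ (⨆ (δ : Γ) (_ : δ ≠ γ), grade δ) = ⊥
  smul_mem : ∀ (τ σ : Γ) (h : G.src τ = G.tgt σ) (a : R) (m : M),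
    a ∈ RG.grade τ → m ∈ grade σ → smul a m ∈ grade (G.comp τ σ h)
  smul_ne : ∀ (τ σ : Γ), G.src τ ≠ G.tgt σ → ∀ (a : R) (m : M),
    a ∈ RG.grade τ → m ∈ grade σ → smul a m = 0
  one_smul : ∀ (σ : Γ) (m : M), m ∈ grade σ → smul (RG.one (G.tgt σ)) m = m

namespace GammaMod

variable {Γ : Type u} {G : Gpd Γ} {R : Type v} [NonUnitalRing R] {RG : GammaRing G R}
  {M : Type w} [AddCommGroup M] (Mod : GammaMod RG M)

/-- `shiftGrade σ γ` is the homogeneous component `M_{σγ}` (zero when undefined):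
the degree-`γ` component of the shifted module `M(σ)`. -/
def shiftGrade (σ γ : Γ) : AddSubgroup M := (G.mul? σ γ).elim ⊥ Mod.grade

/-- `N` is a graded submodule of `M`. -/
def IsGradedSub (N : AddSubgroup M) : Prop :=
  (∀ m ∈ N, ∀ a : R, Mod.smul m a ∈ N) ∧ N ≤ ⨆ γ : Γ, (Mod.grade γ ⊓ N)

/-- `N` is a gr-simple graded submodule of `M`. -/
def IsGrSimpleSub (N : AddSubgroup M) : Prop :=
  Mod.IsGradedSub N ∧ N ≠ ⊥ ∧
    ∀ P : AddSubgroup M, Mod.IsGradedSub P → P ≤ N → P = ⊥ ∨ P = N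

/-- `M` is a gr-simple graded module. -/
def IsGrSimple : Prop := Mod.IsGrSimpleSub ⊤

/-- `M` is a gr-semisimple graded module: it is the sum of its gr-simple graded
submodules. -/
def IsGrSemisimple : Prop :=
  (⨆ (N : AddSubgroup M) (_ : Mod.IsGrSimpleSub N), N) = ⊤

/-- The submodule `M(e) = ⊕_{r(γ) = e} M_γ`. -/
def eComp (e : Γ) : AddSubgroup M := ⨆ (γ : Γ) (_ : G.tgt γ = e), Mod.grade γ

/-- `M` is `Γ₀`-artinian: each `M(e)` satisfies the descending chain condition on
graded submodules. -/
def IsGamma0Artinian : Prop :=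
  ∀ e : Γ, G.IsObj e → ∀ f : ℕ → AddSubgroup M,
    (∀ n, Mod.IsGradedSub (f n) ∧ f n ≤ Mod.eComp e) →
    (∀ n, f (n + 1) ≤ f n) → ∃ n, ∀ k, n ≤ k → f k = f n

/-- `M` is a (nonzero) `Γ₀`-simple module: `M(e)` is gr-simple for every `e ∈ Γ'₀(M)`. -/
def IsGamma0Simple : Prop :=
  (∃ m : M, m ≠ 0) ∧
    ∀ e : Γ, G.IsObj e → Mod.eComp e ≠ ⊥ → Mod.IsGrSimpleSub (Mod.eComp e)

theorem isGradedSub_top : Mod.IsGradedSub (⊤ : AddSubgroup M) := by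
  constructor
  · intro m _ a
    exact AddSubgroup.mem_top _
  · have h : (⨆ γ : Γ, (Mod.grade γ ⊓ (⊤ : AddSubgroup M))) = (⊤ : AddSubgroup M) := by
      simp [Mod.grade_iSup]
    rw [h]

/-- `HomGrade γ` is the homogeneous component `HOM_R(M,M)_γ` of the graded
endomorphism ring `END_R(M)`: the `R`-linear additive endomorphisms `g` with
`g(M_σ) ⊆ M_{γσ}` for all `σ`. -/
def HomGrade (γ : Γ) : Set (M →+ M) :=
  {g | (∀ (m : M) (a : R), g (Mod.smul m a) = Mod.smul (g m) a) ∧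
       ∀ (σ : Γ) (m : M), m ∈ Mod.grade σ → g m ∈ Mod.shiftGrade γ σ}

/-- The graded submodule `N` of `M` is gr-isomorphic to a shift of the graded
submodule `N'` of `M₂`: there are `σ ∈ Γ` and a gr-isomorphism `N ≅ N'(σ)`. -/
def SubIso {M₂ : Type x} [AddCommGroup M₂] (Mod₂ : GammaMod RG M₂)
    (N : AddSubgroup M) (N' : AddSubgroup M₂) (hN : Mod.IsGradedSub N) : Prop :=
  ∃ (σ : Γ) (ψ : N ≃+ N'),
    (∀ (n : N) (a : R),
      ((ψ ⟨Mod.smul n.1 a, hN.1 n.1 n.2 a⟩ : N') : M₂) = Mod₂.smul ((ψ n : N') : M₂) a) ∧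
    ∀ γ : Γ, (fun n : N => ((ψ n : N') : M₂)) '' {n : N | (n : M) ∈ Mod.grade γ}
      = {m : M₂ | m ∈ N' ∧ m ∈ Mod₂.shiftGrade σ γ}

variable {ι : Type y}

/-- A pseudo-linearly independent sequence of homogeneous elements. -/
def PseudoLI (β : ι → Γ) (v : ι → M) : Prop :=
  (∀ i, v i ∈ Mod.grade (β i) ∧ v i ≠ 0) ∧
  ∀ a : ι →₀ R, (∀ i, RG.one (G.src (β i)) * a i = a i) →
    (a.sum fun i r => Mod.smul (v i) r) = 0 → a = 0

/-- A pseudo-basis of `M`: a generating pseudo-linearly independent sequence of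
homogeneous elements. -/
def PseudoBasis (β : ι → Γ) (v : ι → M) : Prop :=
  Mod.PseudoLI β v ∧
    AddSubgroup.closure {m : M | ∃ (i : ι) (r : R), m = Mod.smul (v i) r} = ⊤

/-- `M` is pseudo-free: it has a pseudo-basis. -/
def PseudoFree : Prop :=
  ∃ (κ : Type (max u w)) (β : κ → Γ) (v : κ → M), Mod.PseudoBasis β v

end GammaMod

namespace GammaLMod

variable {Γ : Type u} {G : Gpd Γ} {R : Type v} [NonUnitalRing R] {RG : GammaRing G R}
  {M : Type w} [AddCommGroup M] (Mod : GammaLMod RG M)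

/-- `rshiftGrade σ γ` is the homogeneous component `M_{σγ}` (zero when undefined). -/
def rshiftGrade (σ γ : Γ) : AddSubgroup M := (G.mul? σ γ).elim ⊥ Mod.grade

/-- `N` is a graded left submodule of `M`. -/
def IsGradedSub (N : AddSubgroup M) : Prop :=
  (∀ m ∈ N, ∀ a : R, Mod.smul a m ∈ N) ∧ N ≤ ⨆ γ : Γ, (Mod.grade γ ⊓ N)

def IsGrSimpleSub (N : AddSubgroup M) : Prop :=
  Mod.IsGradedSub N ∧ N ≠ ⊥ ∧
    ∀ P : AddSubgroup M, Mod.IsGradedSub P → P ≤ N → P = ⊥ ∨ P = N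

def IsGrSimple : Prop := Mod.IsGrSimpleSub ⊤

def IsGrSemisimple : Prop :=
  (⨆ (N : AddSubgroup M) (_ : Mod.IsGrSimpleSub N), N) = ⊤

/-- The left submodule `(e)M = ⊕_{d(γ) = e} M_γ`. -/
def lComp (e : Γ) : AddSubgroup M := ⨆ (γ : Γ) (_ : G.src γ = e), Mod.grade γ

def IsGamma0Artinian : Prop :=
  ∀ e : Γ, G.IsObj e → ∀ f : ℕ → AddSubgroup M,
    (∀ n, Mod.IsGradedSub (f n) ∧ f n ≤ Mod.lComp e) →
    (∀ n, f (n + 1) ≤ f n) → ∃ n, ∀ k, n ≤ k → f k = f n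

/-- `V` has finite `Γ₀`-dimension: each `(e)V` has a finite pseudo-basis. -/
def FiniteGamma0Dim : Prop :=
  ∀ e : Γ, G.IsObj e → ∃ (n : ℕ) (γs : Fin n → Γ) (u : Fin n → M),
    (∀ i, G.src (γs i) = e ∧ u i ∈ Mod.grade (γs i) ∧ u i ≠ 0) ∧
    (∀ m ∈ Mod.lComp e,
      m ∈ AddSubgroup.closure {y : M | ∃ (i : Fin n) (a : R), y = Mod.smul a (u i)}) ∧
    ∀ a : Fin n → R, (∀ i, a i * RG.one (G.tgt (γs i)) = a i) →
      (∑ i, Mod.smul (a i) (u i)) = 0 → ∀ i, a i = 0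

end GammaLMod

namespace GammaRing

variable {Γ : Type u} {G : Gpd Γ} {R : Type v} [NonUnitalRing R] (RG : GammaRing G R)

/-- The (right) regular graded module `R_R`. -/
def regular : GammaMod RG R where
  smul := fun m a => m * a
  smul_add := fun m a b => mul_add m a b
  add_smul := fun m n a => add_mul m n a
  smul_mul := fun m a b => (mul_assoc m a b).symm
  grade := RG.grade
  grade_iSup := RG.grade_iSup
  grade_indep := RG.grade_indep
  smul_mem := RG.mul_mem
  smul_ne := RG.mul_ne
  smul_one := RG.mul_one'

/-- The left regular graded module `_R R`. -/
def leftRegular : GammaLMod RG R where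
  smul := fun a m => a * m
  smul_add := fun a m n => mul_add a m n
  add_smul := fun a b m => add_mul a b m
  mul_smul := fun a b m => mul_assoc a b m
  grade := RG.grade
  grade_iSup := RG.grade_iSup
  grade_indep := RG.grade_indep
  smul_mem := RG.mul_mem
  smul_ne := RG.mul_ne
  one_smul := RG.one_mul'

/-- `I` is a graded (two-sided) ideal of `R`. -/
def IsGradedIdeal (I : AddSubgroup R) : Prop :=
  (∀ a ∈ I, ∀ r : R, a * r ∈ I ∧ r * a ∈ I) ∧ I ≤ ⨆ γ : Γ, (RG.grade γ ⊓ I)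

/-- `R` is a gr-simple ring. -/
def IsGrSimpleRing : Prop :=
  (∃ a : R, a ≠ 0) ∧ ∀ I : AddSubgroup R, RG.IsGradedIdeal I → I = ⊥ ∨ I = ⊤

/-- `R` is a gr-prime ring. -/
def IsGrPrime : Prop :=
  (∃ a : R, a ≠ 0) ∧ ∀ I J : AddSubgroup R, RG.IsGradedIdeal I → RG.IsGradedIdeal J →
    I ≠ ⊥ → J ≠ ⊥ → ∃ a ∈ I, ∃ b ∈ J, a * b ≠ 0

/-- `R` is a `Γ`-graded division ring: `R ≠ 0` and every nonzero homogeneous element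
of degree `γ` has an inverse of degree `γ⁻¹`. -/
def IsGrDivision : Prop :=
  (∃ a : R, a ≠ 0) ∧ ∀ (γ : Γ) (a : R), a ∈ RG.grade γ → a ≠ 0 →
    ∃ b ∈ RG.grade (G.inv γ), a * b = RG.one (G.tgt γ) ∧ b * a = RG.one (G.src γ)

/-- `supp(R) ⊆ eΓe`. -/
def SuppLE (e : Γ) : Prop := ∀ γ : Γ, RG.grade γ ≠ ⊥ → G.src γ = e ∧ G.tgt γ = e

def IsRightGrSemisimple : Prop := RG.regular.IsGrSemisimple

def IsLeftGrSemisimple : Prop := RG.leftRegular.IsGrSemisimple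

def IsRightGamma0Artinian : Prop := RG.regular.IsGamma0Artinian

def IsLeftGamma0Artinian : Prop := RG.leftRegular.IsGamma0Artinian

/-- The component ring `R_e` is a division ring with identity `1_e`. -/
def ComponentDivisionRing (e : Γ) : Prop :=
  RG.one e ≠ 0 ∧ ∀ a ∈ RG.grade e, a ≠ 0 →
    ∃ b ∈ RG.grade e, a * b = RG.one e ∧ b * a = RG.one e

/-- The additive subgroup `N` of `R` is, with the induced structure, a gr-simple
graded ring. -/
def SubringGrSimple (N : AddSubgroup R) : Prop :=
  N ≠ ⊥ ∧ ∀ P : AddSubgroup R,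
    (P ≤ N ∧ (∀ p ∈ P, ∀ n ∈ N, p * n ∈ P ∧ n * p ∈ P) ∧
      P ≤ ⨆ γ : Γ, (RG.grade γ ⊓ P)) →
    P = ⊥ ∨ P = N

/-- The additive subgroup `N` of `R` is, with the induced structure, a gr-prime
graded ring. -/
def SubringGrPrime (N : AddSubgroup R) : Prop :=
  (∃ a ∈ N, a ≠ 0) ∧ ∀ P Q : AddSubgroup R,
    (P ≤ N ∧ (∀ p ∈ P, ∀ n ∈ N, p * n ∈ P ∧ n * p ∈ P) ∧
      P ≤ ⨆ γ : Γ, (RG.grade γ ⊓ P)) →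
    (Q ≤ N ∧ (∀ q ∈ Q, ∀ n ∈ N, q * n ∈ Q ∧ n * q ∈ Q) ∧
      Q ≤ ⨆ γ : Γ, (RG.grade γ ⊓ Q)) →
    P ≠ ⊥ → Q ≠ ⊥ → ∃ p ∈ P, ∃ q ∈ Q, p * q ≠ 0

/-- The additive subgroup `N` of `R` is, with the induced structure, a graded
division ring. -/
def SubringGrDivision (N : AddSubgroup R) : Prop :=
  (∃ a ∈ N, a ≠ 0) ∧ ∀ (γ : Γ) (a : R), a ∈ RG.grade γ → a ∈ N → a ≠ 0 →
    RG.one (G.tgt γ) ∈ N ∧ RG.one (G.src γ) ∈ N ∧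
    ∃ b ∈ RG.grade (G.inv γ), b ∈ N ∧ a * b = RG.one (G.tgt γ) ∧ b * a = RG.one (G.src γ)

/-- The additive subgroup `N` of `R` is, with the induced structure, a right
`Γ₀`-artinian graded ring. -/
def SubringRightGamma0Artinian (N : AddSubgroup R) : Prop :=
  ∀ e : Γ, G.IsObj e → ∀ f : ℕ → AddSubgroup R,
    (∀ n, f n ≤ N ⊓ RG.regular.eComp e ∧ (∀ p ∈ f n, ∀ x ∈ N, p * x ∈ f n) ∧
      f n ≤ ⨆ γ : Γ, (RG.grade γ ⊓ f n)) →
    (∀ n, f (n + 1) ≤ f n) → ∃ n, ∀ k, n ≤ k → f k = f n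

end GammaRing

/-- A bundled object unital `Γ`-graded ring. -/
structure BRing.{u', v'} {Γ : Type u'} (G : Gpd Γ) where
  carrier : Type v'
  [ring : NonUnitalRing carrier]
  str : GammaRing G carrier

attribute [instance] BRing.ring

/-- A bundled `Γ`-graded right module over `RG`. -/
structure BMod.{u', v', w'} {Γ : Type u'} {G : Gpd Γ} {R : Type v'} [NonUnitalRing R]
    (RG : GammaRing G R) where
  carrier : Type w'
  [acg : AddCommGroup carrier]
  str : GammaMod RG carrier

attribute [instance] BMod.acg

/-- Two bundled graded modules are in the same isoshift class. -/
def BModSameClass {Γ : Type u} {G : Gpd Γ} {R : Type v} [NonUnitalRing R]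
    {RG : GammaRing G R} (S T : BMod.{u, v, w} RG) : Prop :=
  S.str.SubIso T.str ⊤ ⊤ S.str.isGradedSub_top

/-- The isoshiftical component of `R` of the type of the graded module `S`:
the sum of all graded right ideals of `R` which are gr-simple and lie in the
isoshift class of `S`. -/
def GammaRing.isoComponent {Γ : Type u} {G : Gpd Γ} {R : Type v} [NonUnitalRing R]
    (RG : GammaRing G R) (S : BMod.{u, v, w} RG) : AddSubgroup R :=
  ⨆ (N : AddSubgroup R) (_ : RG.regular.IsGrSimpleSub N ∧
      ∃ hN : RG.regular.IsGradedSub N, RG.regular.SubIso S.str N ⊤ hN), N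

/-- `R` is a pseudo-free module ring: every `Γ`-graded right `R`-module is
pseudo-free. -/
def GammaRing.IsPfm.{u', v', w'} {Γ : Type u'} {G : Gpd Γ} {R : Type v'}
    [NonUnitalRing R] (RG : GammaRing G R) : Prop :=
  ∀ S : BMod.{u', v', w'} RG, S.str.PseudoFree

/-- `R` has invariant pseudo-basis number: any two pseudo-bases of a finitely
generated pseudo-free graded module have the same number of elements. -/
def GammaRing.IPBN.{u', v', w'} {Γ : Type u'} {G : Gpd Γ} {R : Type v'}
    [NonUnitalRing R] (RG : GammaRing G R) : Prop :=
  ∀ (S : BMod.{u', v', w'} RG) (m n : ℕ) (β₁ : Fin m → Γ) (v₁ : Fin m → S.carrier)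
    (β₂ : Fin n → Γ) (v₂ : Fin n → S.carrier),
    S.str.PseudoBasis β₁ v₁ → S.str.PseudoBasis β₂ v₂ → m = n

/-- A `d`-finite sequence of elements of `eΓ`. -/
def DFiniteSeq {Γ : Type u} (G : Gpd Γ) {I : Type w} (e : Γ) (σ : I → Γ) : Prop :=
  (∀ i, G.tgt (σ i) = e) ∧ ∀ f : Γ, {i : I | G.src (σ i) = f}.Finite

/-- The degree-`γ` constraint on the `(i,j)` entry of a homogeneous matrix:
the component `D_{σ_i γ σ_j⁻¹}` (zero when the product is undefined). -/
def entryGrade {Γ : Type u} (G : Gpd Γ) {D : Type v} [NonUnitalRing D]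
    (DG : GammaRing G D) {I : Type w} (σ : I → Γ) (γ : Γ) (i j : I) : AddSubgroup D :=
  (G.conj? (σ i) γ (σ j)).elim ⊥ DG.grade

/-- The `(i,j)` entry of the product of two finitely supported matrices. -/
def matMulEntry {I : Type w} {D : Type v} [NonUnitalRing D]
    (A B : I →₀ I →₀ D) (i j : I) : D :=
  (A i).sum fun k a => a * B k j

/-- `R` is gr-isomorphic to the graded matrix ring `M_I(D)(σ̄)`: there is an
injective additive map from `R` to the finitely supported `I×I` matrices over `D`
which respects matrix multiplication and maps the homogeneous component `R_γ` onto
the set of homogeneous matrices of degree `γ`. -/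
def GammaRing.GrRepMatrix {Γ : Type u} {G : Gpd Γ} {R : Type v} {D : Type x}
    [NonUnitalRing R] [NonUnitalRing D] (RG : GammaRing G R) (DG : GammaRing G D)
    {I : Type w} (σ : I → Γ) : Prop :=
  ∃ φ : R →+ (I →₀ I →₀ D), Function.Injective φ ∧
    (∀ (a b : R) (i j : I), φ (a * b) i j = matMulEntry (φ a) (φ b) i j) ∧
    ∀ γ : Γ, (fun r : R => φ r) '' (RG.grade γ : Set R)
      = {m : I →₀ I →₀ D | ∀ i j : I, m i j ∈ entryGrade G DG σ γ i j}

/-- Entry constraint for matrix rings indexed by a sequence of subsets of `Γ`: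
the component `D_{Σ_i γ Σ_j⁻¹}`. -/
def entryGradeSet {Γ : Type u} (G : Gpd Γ) {D : Type v} [NonUnitalRing D]
    (DG : GammaRing G D) {I : Type w} (Sig : I → Set Γ) (γ : Γ) (i j : I) :
    AddSubgroup D :=
  ⨆ (σ : Γ) (_ : σ ∈ Sig i) (τ : Γ) (_ : τ ∈ Sig j), (G.conj? σ γ τ).elim ⊥ DG.grade

/-- `R` is gr-isomorphic to the graded matrix ring `M_I(D)(Σ̄)` for a sequence of
subsets `Σ̄`. -/
def GammaRing.GrRepMatrixSet {Γ : Type u} {G : Gpd Γ} {R : Type v} {D : Type x}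
    [NonUnitalRing R] [NonUnitalRing D] (RG : GammaRing G R) (DG : GammaRing G D)
    {I : Type w} (Sig : I → Set Γ) : Prop :=
  ∃ φ : R →+ (I →₀ I →₀ D), Function.Injective φ ∧
    (∀ (a b : R) (i j : I), φ (a * b) i j = matMulEntry (φ a) (φ b) i j) ∧
    ∀ γ : Γ, (fun r : R => φ r) '' (RG.grade γ : Set R)
      = {m : I →₀ I →₀ D | ∀ i j : I, m i j ∈ entryGradeSet G DG Sig γ i j}

/-- The family of graded rings `Rj` is summable. -/
def SummableFam {Γ : Type u} {G : Gpd Γ} {J : Type w} (Rj : J → BRing.{u, x} G) : Prop :=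
  ∀ e : Γ, G.IsObj e → {j : J | (Rj j).str.grade e ≠ ⊥}.Finite

/-- `P` (with projections `π`) is the graded direct product `∏^gr_j R_j`. -/
def IsGradedProductB {Γ : Type u} {G : Gpd Γ} {J : Type w} (Rj : J → BRing.{u, x} G)
    {P : Type v} [NonUnitalRing P] (PG : GammaRing G P)
    (π : ∀ j, P →+ (Rj j).carrier) : Prop :=
  (∀ (j : J) (a b : P), π j (a * b) = π j a * π j b) ∧
  (∀ (j : J) (e : Γ), G.IsObj e → π j (PG.one e) = (Rj j).str.one e) ∧
  ∀ (γ : Γ) (xs : ∀ j, (Rj j).carrier), (∀ j, xs j ∈ (Rj j).str.grade γ) →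
    ∃! p : P, p ∈ PG.grade γ ∧ ∀ j, π j p = xs j

/-- `R` and `S` are gr-isomorphic graded rings. -/
def GrIso {Γ : Type u} {G : Gpd Γ} {R : Type v} {S : Type x}
    [NonUnitalRing R] [NonUnitalRing S] (RG : GammaRing G R) (SG : GammaRing G S) :
    Prop :=
  ∃ φ : R ≃+ S, (∀ a b : R, φ (a * b) = φ a * φ b) ∧
    (∀ e : Γ, G.IsObj e → φ (RG.one e) = SG.one e) ∧
    ∀ γ : Γ, (fun a : R => φ a) '' (RG.grade γ : Set R) = (SG.grade γ : Set S)

/-- The gr-primality relation: `1_e D 1_f ≠ 0`. -/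
def GrPrimRel {Γ : Type u} (G : Gpd Γ) {D : Type v} [NonUnitalRing D]
    (DG : GammaRing G D) (e f : Γ) : Prop :=
  ∃ x : D, DG.one e * x * DG.one f ≠ 0

/-- The graded ideal `D_{[e]}` attached to the `∼`-class of `e`. -/
def ClassIdeal {Γ : Type u} (G : Gpd Γ) {D : Type v} [NonUnitalRing D]
    (DG : GammaRing G D) (e : Γ) : AddSubgroup D :=
  ⨆ (γ : Γ) (_ : GrPrimRel G DG (G.tgt γ) e ∧ GrPrimRel G DG (G.src γ) e), DG.grade γ

end
universe u v w x y

namespace Gpd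

/-- The semigroup with zero obtained from `Γ` by adjoining a zero element, the value of the
undefined products. -/
def AdjoinZero {Γ : Type u} (_G : Gpd Γ) : Type u := Option Γ

variable {Γ : Type u} (G : Gpd Γ)

/-- The inclusion of `Γ` in the semigroup with zero `G.AdjoinZero`. -/
def of (γ : Γ) : G.AdjoinZero := some γ

noncomputable instance : Mul G.AdjoinZero where
  mul p q := Option.bind p fun a => Option.bind q fun b => G.mul? a b

instance : Zero G.AdjoinZero where
  zero := none

theorem of_ne_zero (γ : Γ) : G.of γ ≠ 0 := Option.some_ne_none γ

theorem of_injective : Function.Injective G.of := Option.some_injective Γ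

theorem of_mul_of_eq_mul? (γ δ : Γ) : G.of γ * G.of δ = G.mul? γ δ := rfl

variable {G} in
theorem of_mul_of {γ δ : Γ} (h : G.src γ = G.tgt δ) : G.of γ * G.of δ = G.of (G.comp γ δ h) := by
  rw [of_mul_of_eq_mul?, mul?, dif_pos h]; rfl

variable {G} in
theorem of_mul_of_ne {γ δ : Γ} (h : G.src γ ≠ G.tgt δ) : G.of γ * G.of δ = 0 := by
  rw [of_mul_of_eq_mul?, mul?, dif_neg h]; rfl

variable {G} in
theorem adjoinZero_cases {motive : G.AdjoinZero → Prop} (zero : motive 0)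
    (of : ∀ γ, motive (G.of γ)) (p : G.AdjoinZero) : motive p := by
  cases p with
  | none => exact zero
  | some γ => exact of γ

protected theorem zero_mul (p : G.AdjoinZero) : 0 * p = 0 := rfl

protected theorem mul_zero (p : G.AdjoinZero) : p * 0 = 0 := by
  induction p using adjoinZero_cases <;> rfl

noncomputable instance : SemigroupWithZero G.AdjoinZero where
  zero_mul := G.zero_mul
  mul_zero := G.mul_zero
  mul_assoc p q r := by
    induction p using adjoinZero_cases with
    | zero => simp only [G.zero_mul]
    | of a =>
    induction q using adjoinZero_cases with
    | zero => simp only [G.zero_mul, G.mul_zero]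
    | of b =>
    induction r using adjoinZero_cases with
    | zero => simp only [G.mul_zero]
    | of c =>
    by_cases h₁ : G.src a = G.tgt b
    · rw [of_mul_of h₁]
      by_cases h₂ : G.src b = G.tgt c
      · rw [of_mul_of h₂, of_mul_of ((G.src_comp a b h₁).trans h₂),
          of_mul_of (h₁.trans (G.tgt_comp b c h₂).symm), G.comp_assoc]
      · rw [of_mul_of_ne h₂, G.mul_zero, of_mul_of_ne (by rwa [G.src_comp])]
    · rw [of_mul_of_ne h₁, G.zero_mul]
      by_cases h₂ : G.src b = G.tgt c
      · rw [of_mul_of h₂, of_mul_of_ne (by rwa [G.tgt_comp])]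
      · rw [of_mul_of_ne h₂, G.mul_zero]

theorem of_mul_src (γ : Γ) : G.of γ * G.of (G.src γ) = G.of γ := by
  rw [of_mul_of (G.tgt_src γ).symm, G.comp_id]

theorem of_tgt_mul (γ : Γ) : G.of (G.tgt γ) * G.of γ = G.of γ := by
  rw [of_mul_of (G.src_tgt γ), G.id_comp]

theorem of_mul_inv (γ : Γ) : G.of γ * G.of (G.inv γ) = G.of (G.tgt γ) := by
  rw [of_mul_of (G.tgt_inv γ).symm, G.comp_inv]

theorem of_inv_mul (γ : Γ) : G.of (G.inv γ) * G.of γ = G.of (G.src γ) := by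
  rw [of_mul_of (G.src_inv γ), G.inv_comp]

variable {G}

theorem src_eq_tgt_of_mul {γ δ η : Γ} (h : G.of γ * G.of δ = G.of η) : G.src γ = G.tgt δ := by
  by_contra hne
  rw [of_mul_of_ne hne] at h
  exact G.of_ne_zero η h.symm

theorem tgt_of_mul {γ δ η : Γ} (h : G.of γ * G.of δ = G.of η) : G.tgt η = G.tgt γ := by
  have hs := src_eq_tgt_of_mul h
  rw [of_mul_of hs] at h
  rw [← G.of_injective h, G.tgt_comp]

theorem src_of_mul {γ δ η : Γ} (h : G.of γ * G.of δ = G.of η) : G.src η = G.src δ := by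
  have hs := src_eq_tgt_of_mul h
  rw [of_mul_of hs] at h
  rw [← G.of_injective h, G.src_comp]

theorem eq_of_mul_left {γ δ ε η : Γ} (h₁ : G.of γ * G.of δ = G.of η)
    (h₂ : G.of γ * G.of ε = G.of η) : δ = ε := by
  have key : ∀ ζ, G.of γ * G.of ζ = G.of η → G.of ζ = G.of (G.inv γ) * G.of η := by
    intro ζ h
    rw [← h, ← mul_assoc, of_inv_mul, src_eq_tgt_of_mul h, of_tgt_mul]
  exact G.of_injective ((key δ h₁).trans (key ε h₂).symm)

theorem eq_inv_of_mul {γ δ : Γ} (h : G.of γ * G.of δ = G.of (G.tgt γ)) : δ = G.inv γ :=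
  eq_of_mul_left h (G.of_mul_inv γ)

theorem of_mul_eq_right {e γ : Γ} (h : G.tgt γ = e) : G.of e * G.of γ = G.of γ := by
  rw [← h, of_tgt_mul]

theorem of_mul_eq_left {e γ : Γ} (h : G.src γ = e) : G.of γ * G.of e = G.of γ := by
  rw [← h, of_mul_src]

namespace IsObj

variable {e : Γ} (he : G.IsObj e)
include he

theorem src_eq : G.src e = e := he

theorem tgt_eq : G.tgt e = e := by
  conv_lhs => rw [← he.src_eq]
  rw [G.tgt_src, he.src_eq]

theorem of_mul_ne {γ : Γ} (h : G.tgt γ ≠ e) : G.of e * G.of γ = 0 :=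
  of_mul_of_ne (by rw [he.src_eq]; exact h.symm)

theorem mul_of_ne {γ : Γ} (h : G.src γ ≠ e) : G.of γ * G.of e = 0 :=
  of_mul_of_ne (by rwa [he.tgt_eq])

end IsObj

theorem isObj_src (γ : Γ) : G.IsObj (G.src γ) := G.src_src γ

theorem isObj_tgt (γ : Γ) : G.IsObj (G.tgt γ) := G.src_tgt γ

theorem of_conj (σ γ τ : Γ) : G.conj? σ γ τ = G.of σ * G.of γ * G.of (G.inv τ) := by
  rw [of_mul_of_eq_mul?, conj?]
  rcases G.mul? σ γ with _ | η <;> rfl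

end Gpd

theorem exists_projections {Γ : Type u} {M : Type v} [AddCommGroup M] (g : Γ → AddSubgroup M)
    (hsup : ⨆ γ, g γ = ⊤) (hind : ∀ γ, g γ ⊓ (⨆ (δ : Γ) (_ : δ ≠ γ), g δ) = ⊥) :
    ∃ p : Γ → M →+ M, (∀ γ m, p γ m ∈ g γ) ∧ (∀ γ, ∀ m ∈ g γ, p γ m = m) ∧
      (∀ γ δ, γ ≠ δ → ∀ m ∈ g δ, p γ m = 0) ∧
      ∀ (N : AddSubgroup M) (m : M), (∀ γ, p γ m ∈ N) → m ∈ N := by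
  classical
  have hint : Function.Bijective (DirectSum.coeAddMonoidHom g) := by
    constructor
    · exact iSupIndep.dfinsuppSumAddHom_injective fun γ => disjoint_iff.2 (hind γ)
    · intro m
      have hm : m ∈ ⨆ γ, g γ := hsup ▸ AddSubgroup.mem_top m
      refine AddSubgroup.iSup_induction g (C := fun m => ∃ a, DirectSum.coeAddMonoidHom g a = m)
        hm ?_ ⟨0, map_zero _⟩ ?_
      · exact fun γ x hx => ⟨DirectSum.of _ γ ⟨x, hx⟩, DirectSum.coeAddMonoidHom_of _ _ _⟩
      · rintro _ _ ⟨a, rfl⟩ ⟨b, rfl⟩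
        exact ⟨a + b, map_add _ _ _⟩
  let E := AddEquiv.ofBijective _ hint
  have hE : ∀ (γ : Γ) (m : M) (hm : m ∈ g γ), E.symm m = DirectSum.of (fun γ => g γ) γ ⟨m, hm⟩ := by
    intro γ m hm
    rw [AddEquiv.symm_apply_eq]
    exact (DirectSum.coeAddMonoidHom_of g γ ⟨m, hm⟩).symm
  refine ⟨fun γ => (g γ).subtype.comp
    ((DFinsupp.evalAddMonoidHom γ).comp E.symm.toAddMonoidHom), ?_, ?_, ?_, ?_⟩
  · exact fun γ m => Subtype.property _
  · intro γ m hm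
    change ((E.symm m) γ : M) = m
    rw [hE γ m hm, DirectSum.of_eq_same]
  · intro γ δ hne m hm
    change ((E.symm m) γ : M) = 0
    rw [hE δ m hm, DirectSum.of_eq_of_ne _ _ _ hne]
    rfl
  · intro N m h
    obtain ⟨a, rfl⟩ := E.surjective m
    change DirectSum.coeAddMonoidHom g a ∈ N
    rw [DirectSum.coeAddMonoidHom_eq_dfinsuppSum]
    refine AddSubgroup.sum_mem _ fun γ _ => ?_
    have := h γ
    change ((E.symm (E a)) γ : M) ∈ N at this
    rwa [E.symm_apply_apply] at this

namespace GammaRing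

variable {Γ : Type u} {G : Gpd Γ} {R : Type v} [NonUnitalRing R] (RG : GammaRing G R)

/-- The grading extended to `G.AdjoinZero` by zero. -/
def gradeZ (p : G.AdjoinZero) : AddSubgroup R := Option.elim p ⊥ RG.grade

theorem gradeZ_of (γ : Γ) : RG.gradeZ (G.of γ) = RG.grade γ := rfl

theorem gradeZ_zero : RG.gradeZ 0 = ⊥ := rfl

variable {RG}

theorem mul_mem_gradeZ {p q : G.AdjoinZero} {a b : R} (ha : a ∈ RG.gradeZ p)
    (hb : b ∈ RG.gradeZ q) : a * b ∈ RG.gradeZ (p * q) := by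
  induction p using Gpd.adjoinZero_cases with
  | zero =>
    rw [gradeZ_zero, AddSubgroup.mem_bot] at ha
    rw [ha, zero_mul b]
    exact (RG.gradeZ _).zero_mem
  | of γ =>
  induction q using Gpd.adjoinZero_cases with
  | zero =>
    rw [gradeZ_zero, AddSubgroup.mem_bot] at hb
    rw [hb, mul_zero a]
    exact (RG.gradeZ _).zero_mem
  | of δ =>
    by_cases h : G.src γ = G.tgt δ
    · rw [Gpd.of_mul_of h]
      exact RG.mul_mem γ δ h a b ha hb
    · rw [Gpd.of_mul_of_ne h, gradeZ_zero, AddSubgroup.mem_bot]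
      exact RG.mul_ne γ δ h a b ha hb

theorem mul_mem_grade {γ δ η : Γ} (h : G.of γ * G.of δ = G.of η) {a b : R}
    (ha : a ∈ RG.grade γ) (hb : b ∈ RG.grade δ) : a * b ∈ RG.grade η := by
  rw [← gradeZ_of, ← h]
  exact mul_mem_gradeZ ha hb

theorem exists_of_mem_gradeZ_ne_zero {p : G.AdjoinZero} {a : R} (ha : a ∈ RG.gradeZ p)
    (h0 : a ≠ 0) : ∃ γ, p = G.of γ ∧ a ∈ RG.grade γ := by
  induction p using Gpd.adjoinZero_cases with
  | zero => exact absurd ha h0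
  | of γ => exact ⟨γ, rfl, ha⟩

/-- The product of homogeneous elements is zero or homogeneous. -/
theorem exists_mul_mem_grade {γ δ : Γ} {a b : R} (ha : a ∈ RG.grade γ) (hb : b ∈ RG.grade δ)
    (h0 : a * b ≠ 0) : ∃ η, G.of γ * G.of δ = G.of η ∧ a * b ∈ RG.grade η :=
  exists_of_mem_gradeZ_ne_zero (mul_mem_gradeZ (p := G.of γ) (q := G.of δ) ha hb) h0

theorem homogeneous_induction {p : R → Prop} (r : R) (zero : p 0)
    (hom : ∀ γ, ∀ a ∈ RG.grade γ, p a) (add : ∀ a b, p a → p b → p (a + b)) : p r :=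
  AddSubgroup.iSup_induction RG.grade (C := p) (RG.grade_iSup ▸ AddSubgroup.mem_top r) hom zero add

theorem eq_of_grade_ne {γ δ : Γ} {a : R} (h₁ : a ∈ RG.grade γ) (h₂ : a ∈ RG.grade δ)
    (h0 : a ≠ 0) : γ = δ := by
  by_contra hne
  have hmem : a ∈ RG.grade γ ⊓ ⨆ (δ : Γ) (_ : δ ≠ γ), RG.grade δ :=
    ⟨h₁, AddSubgroup.mem_iSup_of_mem δ (AddSubgroup.mem_iSup_of_mem (Ne.symm hne) h₂)⟩
  rw [RG.grade_indep] at hmem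
  exact h0 hmem

variable (RG) in
/-- The projection of `R` onto its homogeneous component of degree `γ`. -/
noncomputable def proj (γ : Γ) : R →+ R :=
  (exists_projections RG.grade RG.grade_iSup RG.grade_indep).choose γ

theorem proj_mem (γ : Γ) (r : R) : RG.proj γ r ∈ RG.grade γ :=
  (exists_projections RG.grade RG.grade_iSup RG.grade_indep).choose_spec.1 γ r

theorem proj_of_mem {γ : Γ} {r : R} (h : r ∈ RG.grade γ) : RG.proj γ r = r :=
  (exists_projections RG.grade RG.grade_iSup RG.grade_indep).choose_spec.2.1 γ r h

theorem proj_of_mem_ne {γ δ : Γ} (hne : γ ≠ δ) {r : R} (h : r ∈ RG.grade δ) :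
    RG.proj γ r = 0 :=
  (exists_projections RG.grade RG.grade_iSup RG.grade_indep).choose_spec.2.2.1 γ δ hne r h

theorem mem_of_forall_proj_mem {N : AddSubgroup R} {r : R} (h : ∀ γ, RG.proj γ r ∈ N) : r ∈ N :=
  (exists_projections RG.grade RG.grade_iSup RG.grade_indep).choose_spec.2.2.2 N r h

theorem proj_mul {γ δ η : Γ} (h : G.of δ * G.of γ = G.of η) {a : R} (ha : a ∈ RG.grade δ)
    (s : R) : RG.proj η (a * s) = a * RG.proj γ s := by
  induction s using homogeneous_induction (RG := RG) with
  | zero => rw [mul_zero, map_zero, map_zero, mul_zero]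
  | add s t hs ht => rw [mul_add, map_add, map_add, mul_add, hs, ht]
  | hom ε s hs =>
    by_cases hγ : γ = ε
    · subst hγ
      rw [proj_of_mem hs, proj_of_mem (mul_mem_grade h ha hs)]
    · rw [proj_of_mem_ne hγ hs, mul_zero]
      by_cases h0 : a * s = 0
      · rw [h0, map_zero]
      · obtain ⟨ζ, hζ, hmem⟩ := exists_mul_mem_grade ha hs h0
        refine proj_of_mem_ne ?_ hmem
        rintro rfl
        exact hγ (Gpd.eq_of_mul_left h hζ)

theorem one_mul_of_tgt {e γ : Γ} (h : G.tgt γ = e) {a : R} (ha : a ∈ RG.grade γ) :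
    RG.one e * a = a := h ▸ RG.one_mul' γ a ha

theorem mul_one_of_src {e γ : Γ} (h : G.src γ = e) {a : R} (ha : a ∈ RG.grade γ) :
    a * RG.one e = a := h ▸ RG.mul_one' γ a ha

theorem isGradedSub_iff {N : AddSubgroup R} :
    RG.regular.IsGradedSub N ↔
      (∀ m ∈ N, ∀ a, m * a ∈ N) ∧ ∀ m ∈ N, ∀ γ, RG.proj γ m ∈ N := by
  refine and_congr Iff.rfl ⟨fun h m hm γ => ?_, fun h m hm => ?_⟩
  · refine AddSubgroup.iSup_induction (fun γ => RG.grade γ ⊓ N) (C := fun m => RG.proj γ m ∈ N)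
      (h hm) ?_ (by rw [map_zero]; exact zero_mem _) ?_
    · rintro δ x ⟨hx, hxN⟩
      by_cases hγ : γ = δ
      · subst hγ
        rwa [proj_of_mem hx]
      · rw [proj_of_mem_ne hγ hx]
        exact zero_mem _
    · intro x y hx hy
      rw [map_add]
      exact add_mem hx hy
  · exact mem_of_forall_proj_mem (RG := RG) fun γ =>
      AddSubgroup.mem_iSup_of_mem γ ⟨proj_mem γ m, h m hm γ⟩

theorem isGradedSub_inf {N P : AddSubgroup R} (hN : RG.regular.IsGradedSub N)
    (hP : RG.regular.IsGradedSub P) : RG.regular.IsGradedSub (N ⊓ P) := by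
  rw [isGradedSub_iff] at *
  exact ⟨fun m hm a => ⟨hN.1 m hm.1 a, hP.1 m hm.2 a⟩,
    fun m hm γ => ⟨hN.2 m hm.1 γ, hP.2 m hm.2 γ⟩⟩

theorem isGradedSub_sup {N P : AddSubgroup R} (hN : RG.regular.IsGradedSub N)
    (hP : RG.regular.IsGradedSub P) : RG.regular.IsGradedSub (N ⊔ P) := by
  rw [isGradedSub_iff] at *
  constructor
  · intro m hm a
    obtain ⟨n, hn, p, hp, rfl⟩ := AddSubgroup.mem_sup.1 hm
    rw [add_mul]
    exact AddSubgroup.add_mem_sup (hN.1 n hn a) (hP.1 p hp a)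
  · intro m hm γ
    obtain ⟨n, hn, p, hp, rfl⟩ := AddSubgroup.mem_sup.1 hm
    rw [map_add]
    exact AddSubgroup.add_mem_sup (hN.2 n hn γ) (hP.2 p hp γ)

theorem isGradedSub_bot : RG.regular.IsGradedSub ⊥ := by
  rw [isGradedSub_iff]
  simp

theorem isGradedSub_map_mulLeft {N : AddSubgroup R} (hN : RG.regular.IsGradedSub N) {δ : Γ} {a : R}
    (ha : a ∈ RG.grade δ) : RG.regular.IsGradedSub (N.map (AddMonoidHom.mulLeft a)) := by
  rw [isGradedSub_iff] at hN
  constructor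
  · rintro _ ⟨n, hn, rfl⟩ b
    exact ⟨n * b, hN.1 n hn b, (mul_assoc a n b).symm⟩
  · rintro _ ⟨n, hn, rfl⟩
    rw [← AddSubgroup.mem_comap]
    refine mem_of_forall_proj_mem (RG := RG) fun γ => ?_
    rw [AddSubgroup.mem_comap]
    change a * RG.proj γ n ∈ _
    by_cases h0 : a * RG.proj γ n = 0
    · rw [h0]
      exact zero_mem _
    · obtain ⟨η, -, hη⟩ := exists_mul_mem_grade ha (proj_mem γ n) h0
      exact AddSubgroup.mem_iSup_of_mem η ⟨hη, RG.proj γ n, hN.2 n hn γ, rfl⟩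

theorem isGradedSub_inf_ker_mulLeft {N : AddSubgroup R} (hN : RG.regular.IsGradedSub N) {δ : Γ}
    {a : R} (ha : a ∈ RG.grade δ) : RG.regular.IsGradedSub (N ⊓ (AddMonoidHom.mulLeft a).ker) := by
  rw [isGradedSub_iff] at *
  constructor
  · rintro n ⟨hn, hker⟩ b
    replace hker : a * n = 0 := hker
    exact ⟨hN.1 n hn b, show a * (n * b) = 0 by rw [← mul_assoc, hker, zero_mul]⟩
  · rintro n ⟨hn, hker⟩ γ
    replace hker : a * n = 0 := hker
    refine ⟨hN.2 n hn γ, show a * RG.proj γ n = 0 from ?_⟩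
    by_contra h0
    obtain ⟨η, hη, -⟩ := exists_mul_mem_grade ha (proj_mem γ n) h0
    rw [← proj_mul hη ha, hker, map_zero] at h0
    exact h0 rfl

theorem exists_homogeneous_of_ne_bot {N : AddSubgroup R} (hN : N ≤ ⨆ γ, (RG.grade γ ⊓ N))
    (h0 : N ≠ ⊥) : ∃ γ, ∃ a ∈ RG.grade γ, a ∈ N ∧ a ≠ 0 := by
  by_contra! h
  refine h0 (le_bot_iff.1 (hN.trans (iSup_le fun γ a ha => ?_)))
  exact h γ a ha.1 ha.2

end GammaRing

/-- A family of homogeneous elements `x i` and `y i` behaving like the first column and the first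
row of a system of matrix units with corner `u ∈ R_e`. -/
structure MatrixUnits {Γ : Type u} {G : Gpd Γ} {R : Type v} [NonUnitalRing R] (RG : GammaRing G R)
    (e : Γ) (u : R) {I : Type w} (σ : I → Γ) (x y : I → R) : Prop where
  isObj : G.IsObj e
  u_mem : u ∈ RG.grade e
  tgt : ∀ i, G.tgt (σ i) = e
  fin : ∀ f, {i | G.src (σ i) = f}.Finite
  x_mem : ∀ i, x i ∈ RG.grade (G.inv (σ i))
  y_mem : ∀ i, y i ∈ RG.grade (σ i)
  x_mul_u : ∀ i, x i * u = x i
  u_mul_y : ∀ i, u * y i = y i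
  y_mul_x : ∀ i, y i * x i = u
  y_mul_x_ne : ∀ i j, i ≠ j → y i * x j = 0
  sum_eq : ∀ f, G.IsObj f → ∑ i ∈ (fin f).toFinset, x i * y i = RG.one f

namespace MatrixUnits

variable {Γ : Type u} {G : Gpd Γ} {R : Type v} [NonUnitalRing R] {RG : GammaRing G R}
  {e : Γ} {u : R} {I : Type w} {σ : I → Γ} {x y : I → R} (H : MatrixUnits RG e u σ x y)
include H

theorem mul_x_eq_zero {γ : Γ} {a : R} (ha : a ∈ RG.grade γ) {i : I}
    (hi : G.src (σ i) ≠ G.src γ) : a * x i = 0 :=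
  RG.mul_ne _ _ (by rw [G.tgt_inv]; exact hi.symm) _ _ ha (H.x_mem i)

theorem y_mul_eq_zero {γ : Γ} {a : R} (ha : a ∈ RG.grade γ) {i : I}
    (hi : G.src (σ i) ≠ G.tgt γ) : y i * a = 0 :=
  RG.mul_ne _ _ hi _ _ (H.y_mem i) ha

theorem exists_finset_right (a : R) :
    ∃ T : Finset I, (∀ i ∉ T, a * x i = 0) ∧
      ∀ T', T ⊆ T' → ∑ i ∈ T', a * x i * y i = a := by
  classical
  suffices h : ∃ T : Finset I, (∀ i ∉ T, a * x i = 0) ∧ ∑ i ∈ T, a * x i * y i = a by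
    obtain ⟨T, h0, hT⟩ := h
    refine ⟨T, h0, fun T' hTT' => ?_⟩
    rw [← Finset.sum_subset hTT' fun i _ hi => by rw [h0 i hi, zero_mul], hT]
  induction a using GammaRing.homogeneous_induction (RG := RG) with
  | zero => exact ⟨∅, by simp⟩
  | hom γ a ha =>
    refine ⟨(H.fin (G.src γ)).toFinset, fun i hi => H.mul_x_eq_zero ha (by simpa using hi), ?_⟩
    simp_rw [mul_assoc]
    rw [← Finset.mul_sum, H.sum_eq _ (Gpd.isObj_src γ), RG.mul_one' γ a ha]
  | add a b hA hB =>
    obtain ⟨S, hS, hSa⟩ := hA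
    obtain ⟨T, hT, hTb⟩ := hB
    refine ⟨S ∪ T, fun i hi => ?_, ?_⟩
    · rw [Finset.notMem_union] at hi
      rw [add_mul, hS i hi.1, hT i hi.2, add_zero]
    · simp_rw [add_mul]
      rw [Finset.sum_add_distrib,
        ← Finset.sum_subset Finset.subset_union_left fun i _ hi => by rw [hS i hi, zero_mul],
        ← Finset.sum_subset Finset.subset_union_right fun i _ hi => by rw [hT i hi, zero_mul],
        hSa, hTb]

theorem exists_finset_left (a : R) :
    ∃ T : Finset I, (∀ i ∉ T, y i * a = 0) ∧
      ∀ T', T ⊆ T' → ∑ i ∈ T', x i * (y i * a) = a := by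
  classical
  suffices h : ∃ T : Finset I, (∀ i ∉ T, y i * a = 0) ∧ ∑ i ∈ T, x i * (y i * a) = a by
    obtain ⟨T, h0, hT⟩ := h
    refine ⟨T, h0, fun T' hTT' => ?_⟩
    rw [← Finset.sum_subset hTT' fun i _ hi => by rw [h0 i hi, mul_zero], hT]
  induction a using GammaRing.homogeneous_induction (RG := RG) with
  | zero => exact ⟨∅, by simp⟩
  | hom γ a ha =>
    refine ⟨(H.fin (G.tgt γ)).toFinset, fun i hi => H.y_mul_eq_zero ha (by simpa using hi), ?_⟩
    simp_rw [← mul_assoc]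
    rw [← Finset.sum_mul, H.sum_eq _ (Gpd.isObj_tgt γ), RG.one_mul' γ a ha]
  | add a b hA hB =>
    obtain ⟨S, hS, hSa⟩ := hA
    obtain ⟨T, hT, hTb⟩ := hB
    refine ⟨S ∪ T, fun i hi => ?_, ?_⟩
    · rw [Finset.notMem_union] at hi
      rw [mul_add, hS i hi.1, hT i hi.2, add_zero]
    · simp_rw [mul_add]
      rw [Finset.sum_add_distrib,
        ← Finset.sum_subset Finset.subset_union_left fun i _ hi => by rw [hS i hi, mul_zero],
        ← Finset.sum_subset Finset.subset_union_right fun i _ hi => by rw [hT i hi, mul_zero],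
        hSa, hTb]

theorem eq_zero_of_mul_x {a : R} (h : ∀ j, a * x j = 0) : a = 0 := by
  obtain ⟨T, -, hT⟩ := H.exists_finset_right a
  rw [← hT T subset_rfl]
  exact Finset.sum_eq_zero fun j _ => by rw [h, zero_mul]

theorem eq_zero_of_y_mul {a : R} (h : ∀ i, y i * a = 0) : a = 0 := by
  obtain ⟨T, -, hT⟩ := H.exists_finset_left a
  rw [← hT T subset_rfl]
  exact Finset.sum_eq_zero fun i _ => by rw [h, mul_zero]

/-- A nonzero homogeneous element of `u R` divides `u` from the left if the nonzero homogeneous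
elements of `u R u` do. -/
theorem exists_mul_eq_u
    (hdiv : ∀ γ, ∀ a ∈ RG.grade γ, a ≠ 0 → u * a = a → a * u = a → ∃ b, a * b = u)
    {γ : Γ} {a : R} (ha : a ∈ RG.grade γ) (h0 : a ≠ 0) (hua : u * a = a) : ∃ b, a * b = u := by
  obtain ⟨j, hj⟩ : ∃ j, a * x j ≠ 0 := by
    by_contra! h
    exact h0 (H.eq_zero_of_mul_x h)
  obtain ⟨η, -, hη⟩ := GammaRing.exists_mul_mem_grade ha (H.x_mem j) hj
  obtain ⟨b, hb⟩ := hdiv η _ hη hj (by rw [← mul_assoc, hua]) (by rw [mul_assoc, H.x_mul_u])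
  exact ⟨x j * b, by rw [← mul_assoc, hb]⟩

theorem isGrSimpleRing (hu : u ≠ 0)
    (hdiv : ∀ γ, ∀ a ∈ RG.grade γ, a ≠ 0 → u * a = a → a * u = a → ∃ b, a * b = u) :
    RG.IsGrSimpleRing := by
  refine ⟨⟨u, hu⟩, fun J hJ => or_iff_not_imp_left.2 fun hne => ?_⟩
  obtain ⟨γ, a, ha, haJ, h0⟩ := GammaRing.exists_homogeneous_of_ne_bot hJ.2 hne
  obtain ⟨i, hi⟩ : ∃ i, y i * a ≠ 0 := by
    by_contra! h
    exact h0 (H.eq_zero_of_y_mul h)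
  obtain ⟨η, -, hη⟩ := GammaRing.exists_mul_mem_grade (H.y_mem i) ha hi
  obtain ⟨b, hb⟩ := H.exists_mul_eq_u hdiv hη hi (by rw [← mul_assoc, H.u_mul_y])
  have huJ : u ∈ J := hb ▸ (hJ.1 _ (hJ.1 a haJ (y i)).2 b).1
  have hone : ∀ f, G.IsObj f → RG.one f ∈ J := by
    intro f hf
    rw [← H.sum_eq f hf]
    refine sum_mem fun i _ => ?_
    rw [← H.x_mul_u i]
    exact (hJ.1 _ (hJ.1 u huJ (x i)).2 (y i)).1
  refine (AddSubgroup.eq_top_iff' J).2 fun r => ?_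
  induction r using GammaRing.homogeneous_induction (RG := RG) with
  | zero => exact zero_mem J
  | hom γ a ha =>
    rw [← RG.mul_one' γ a ha]
    exact (hJ.1 _ (hone _ (Gpd.isObj_src γ)) a).2
  | add a b hA hB => exact add_mem hA hB

theorem isGrSimpleSub_map_x (hu : u ≠ 0)
    (hdiv : ∀ γ, ∀ a ∈ RG.grade γ, a ≠ 0 → u * a = a → a * u = a → ∃ b, a * b = u) (i : I) :
    RG.regular.IsGrSimpleSub ((⊤ : AddSubgroup R).map (AddMonoidHom.mulLeft (x i))) := by
  refine ⟨GammaRing.isGradedSub_map_mulLeft RG.regular.isGradedSub_top (H.x_mem i), ?_, ?_⟩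
  · intro h
    have hx : x i * u = 0 := (AddSubgroup.eq_bot_iff_forall _).1 h _ ⟨u, trivial, rfl⟩
    rw [← H.y_mul_x i, ← H.x_mul_u i, hx, mul_zero] at hu
    exact hu rfl
  · refine fun N hN hle => or_iff_not_imp_left.2 fun hne => le_antisymm hle ?_
    obtain ⟨γ, n, hn, hnN, h0⟩ := GammaRing.exists_homogeneous_of_ne_bot hN.2 hne
    have hxy : x i * (y i * n) = n := by
      obtain ⟨r, -, rfl⟩ := hle hnN
      change x i * (y i * (x i * r)) = x i * r
      rw [← mul_assoc (y i), H.y_mul_x, ← mul_assoc, H.x_mul_u]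
    have hyn : y i * n ≠ 0 := fun h => h0 (by rw [← hxy, h, mul_zero])
    obtain ⟨η, -, hη⟩ := GammaRing.exists_mul_mem_grade (H.y_mem i) hn hyn
    obtain ⟨b, hb⟩ := H.exists_mul_eq_u hdiv hη hyn (by rw [← mul_assoc, H.u_mul_y])
    rintro _ ⟨r, -, rfl⟩
    have hr : x i * r = n * (b * r) := by
      rw [← H.x_mul_u i, ← hb, ← mul_assoc (x i), hxy, mul_assoc]
    change x i * r ∈ N
    rw [hr]
    exact hN.1 n hnN (b * r)

end MatrixUnits

namespace GammaRing

variable {Γ : Type u} {G : Gpd Γ} {R : Type v} [NonUnitalRing R] (RG : GammaRing G R)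

/-- The descending chain condition on graded right ideals contained in `N`. -/
def IsArtinianBelow (N : AddSubgroup R) : Prop :=
  ∀ f : ℕ → AddSubgroup R, (∀ n, RG.regular.IsGradedSub (f n) ∧ f n ≤ N) →
    (∀ n, f (n + 1) ≤ f n) → ∃ n, ∀ k, n ≤ k → f k = f n

variable {RG}

theorem isArtinianBelow_bot : RG.IsArtinianBelow ⊥ := fun _ hf _ =>
  ⟨0, fun k _ => (le_bot_iff.1 (hf k).2).trans (le_bot_iff.1 (hf 0).2).symm⟩

theorem IsArtinianBelow.mono {N P : AddSubgroup R} (hP : RG.IsArtinianBelow P) (h : N ≤ P) :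
    RG.IsArtinianBelow N := fun _ hf =>
  hP _ fun n => ⟨(hf n).1, (hf n).2.trans h⟩

theorem IsArtinianBelow.sup_isGrSimpleSub {S P : AddSubgroup R} (hS : RG.regular.IsGrSimpleSub S)
    (hPg : RG.regular.IsGradedSub P) (hP : RG.IsArtinianBelow P) : RG.IsArtinianBelow (S ⊔ P) := by
  intro f hf hstep
  have hanti : Antitone f := antitone_nat_of_succ_le hstep
  obtain ⟨n, hn⟩ := hP (fun n => f n ⊓ P)
    (fun n => ⟨isGradedSub_inf (hf n).1 hPg, inf_le_right⟩)
    (fun n => inf_le_inf_right P (hstep n))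
  have hcase : ∀ k, f k ⊔ P = P ∨ f k ⊔ P = S ⊔ P := by
    intro k
    rcases hS.2.2 ((P ⊔ f k) ⊓ S)
      (isGradedSub_inf (isGradedSub_sup hPg (hf k).1) hS.1) inf_le_right with h | h
    · left
      refine le_antisymm ?_ le_sup_right
      calc f k ⊔ P ≤ (P ⊔ S) ⊓ (P ⊔ f k) :=
            le_inf (sup_le ((hf k).2.trans (sup_comm S P).le) le_sup_left) (sup_comm _ _).le
        _ = P ⊔ S ⊓ (P ⊔ f k) := sup_inf_assoc_of_le S le_sup_left
        _ = P := by rw [inf_comm, h, sup_bot_eq]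
    · right
      exact le_antisymm (sup_le (hf k).2 le_sup_right)
        (sup_le ((inf_eq_right.1 h).trans (sup_comm ..).le) le_sup_right)
  obtain ⟨m, hm⟩ : ∃ m, ∀ k, m ≤ k → f k ⊔ P = f m ⊔ P := by
    by_cases h : ∃ m, f m ⊔ P = P
    · obtain ⟨m, hm⟩ := h
      refine ⟨m, fun k hk => ?_⟩
      rw [hm]
      exact le_antisymm ((sup_le_sup_right (hanti hk) P).trans hm.le) le_sup_right
    · push Not at h
      exact ⟨0, fun k _ => ((hcase k).resolve_left (h k)).trans
        ((hcase 0).resolve_left (h 0)).symm⟩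
  refine ⟨max n m, fun k hk => ?_⟩
  refine eq_of_le_of_inf_le_of_sup_le (z := P) (hanti hk) ?_ ?_
  · have h₁ := hn k ((le_max_left n m).trans hk)
    have h₂ := hn (max n m) (le_max_left n m)
    exact (h₂.trans h₁.symm).le
  · have h₁ := hm k ((le_max_right n m).trans hk)
    have h₂ := hm (max n m) (le_max_right n m)
    exact (h₂.trans h₁.symm).le

end GammaRing

theorem MatrixUnits.isRightGamma0Artinian {Γ : Type u} {G : Gpd Γ} {R : Type v} [NonUnitalRing R]
    {RG : GammaRing G R} {e : Γ} {u : R} {I : Type w} {σ : I → Γ} {x y : I → R}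
    (H : MatrixUnits RG e u σ x y) (hu : u ≠ 0)
    (hdiv : ∀ γ, ∀ a ∈ RG.grade γ, a ≠ 0 → u * a = a → a * u = a → ∃ b, a * b = u) :
    RG.IsRightGamma0Artinian := by
  classical
  intro f hf
  let X : I → AddSubgroup R := fun i => (⊤ : AddSubgroup R).map (AddMonoidHom.mulLeft (x i))
  have hX := H.isGrSimpleSub_map_x hu hdiv
  have hT : ∀ T : Finset I, RG.regular.IsGradedSub (T.sup X) ∧ RG.IsArtinianBelow (T.sup X) := by
    intro T
    induction T using Finset.induction_on with
    | empty => exact ⟨GammaRing.isGradedSub_bot, GammaRing.isArtinianBelow_bot⟩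
    | insert i T _ ih =>
      rw [Finset.sup_insert]
      exact ⟨GammaRing.isGradedSub_sup (hX i).1 ih.1, ih.2.sup_isGrSimpleSub (hX i) ih.1⟩
  refine (hT (H.fin f).toFinset).2.mono ?_
  refine iSup₂_le fun γ hγ a ha => ?_
  rw [← GammaRing.one_mul_of_tgt hγ ha, ← H.sum_eq f hf, Finset.sum_mul]
  refine sum_mem fun i hi => ?_
  exact Finset.le_sup (f := X) hi ⟨y i * a, trivial, (mul_assoc _ _ _).symm⟩

theorem matMulEntry_single_left {I : Type w} {D : Type v} [NonUnitalRing D] (i j : I) (d : D)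
    (B : I →₀ I →₀ D) (k l : I) :
    matMulEntry (Finsupp.single i (Finsupp.single j d)) B k l
      = Finsupp.single i (d * B j l) k := by
  classical
  unfold matMulEntry
  by_cases h : i = k
  · subst h
    rw [Finsupp.single_eq_same, Finsupp.single_eq_same, Finsupp.sum_single_index (zero_mul _)]
  · rw [Finsupp.single_eq_of_ne' h, Finsupp.single_eq_of_ne' h, Finsupp.sum_zero_index]

theorem matMulEntry_single_right {I : Type w} {D : Type v} [NonUnitalRing D] (i j : I) (d : D)
    (A : I →₀ I →₀ D) (k l : I) :
    matMulEntry A (Finsupp.single i (Finsupp.single j d)) k l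
      = Finsupp.single j (A k i * d) l := by
  classical
  unfold matMulEntry
  rw [Finsupp.sum_eq_single i]
  · rw [Finsupp.single_eq_same]
    by_cases h : j = l
    · subst h
      rw [Finsupp.single_eq_same, Finsupp.single_eq_same]
    · rw [Finsupp.single_eq_of_ne' h, Finsupp.single_eq_of_ne' h, mul_zero]
  · intro m _ hm
    rw [Finsupp.single_eq_of_ne hm, Finsupp.zero_apply, mul_zero]
  · exact fun _ => zero_mul _

namespace Gpd

variable {Γ : Type u} {G : Gpd Γ}

theorem of_inv_comp_inv {a b : Γ} (h : G.tgt a = G.tgt b) :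
    G.of (G.inv (G.comp (G.inv a) b ((G.src_inv a).trans h))) = G.of (G.inv b) * G.of a := by
  have hba : G.src (G.inv b) = G.tgt a := (G.src_inv b).trans h.symm
  rw [of_mul_of hba]
  congr 1
  refine (eq_inv_of_mul ?_).symm
  rw [← of_mul_of hba, ← of_mul_of, G.tgt_comp, G.tgt_inv, mul_assoc, ← mul_assoc (G.of b),
    of_mul_inv, ← h, of_tgt_mul, of_inv_mul]

/-- Every `ζ` is of the form `a γ b⁻¹` when the sources and targets match. -/
theorem exists_conj_eq {a b ζ : Γ} (ha : G.tgt a = G.tgt ζ) (hb : G.tgt b = G.src ζ) :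
    ∃ γ, G.of a * G.of γ * G.of (G.inv b) = G.of ζ := by
  have h₁ : G.src (G.inv a) = G.tgt ζ := (G.src_inv a).trans ha
  have h₂ : G.src (G.comp (G.inv a) ζ h₁) = G.tgt b := (G.src_comp _ _ _).trans hb.symm
  refine ⟨G.comp (G.comp (G.inv a) ζ h₁) b h₂, ?_⟩
  rw [← of_mul_of h₂, ← of_mul_of h₁, mul_assoc, mul_assoc, of_mul_inv, hb, mul_assoc, of_mul_src,
    ← mul_assoc, of_mul_inv, ha, of_tgt_mul]

end Gpd

namespace GammaRing

variable {Γ : Type u} {G : Gpd Γ} {D : Type v} [NonUnitalRing D] {DG : GammaRing G D} {e : Γ}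

theorem SuppLE.src_tgt_eq (h : DG.SuppLE e) {γ : Γ} {d : D} (hd : d ∈ DG.grade γ) (h0 : d ≠ 0) :
    G.src γ = e ∧ G.tgt γ = e :=
  h γ fun hbot => h0 (by rwa [hbot, AddSubgroup.mem_bot] at hd)

theorem SuppLE.one_mul (h : DG.SuppLE e) (d : D) : DG.one e * d = d := by
  induction d using homogeneous_induction (RG := DG) with
  | zero => exact mul_zero _
  | hom γ d hd =>
    by_cases h0 : d = 0
    · rw [h0, mul_zero]
    · exact one_mul_of_tgt (h.src_tgt_eq hd h0).2 hd
  | add a b ha hb => rw [mul_add, ha, hb]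

theorem SuppLE.mul_one (h : DG.SuppLE e) (d : D) : d * DG.one e = d := by
  induction d using homogeneous_induction (RG := DG) with
  | zero => exact zero_mul _
  | hom γ d hd =>
    by_cases h0 : d = 0
    · rw [h0, zero_mul]
    · exact mul_one_of_src (h.src_tgt_eq hd h0).1 hd
  | add a b ha hb => rw [add_mul, ha, hb]

end GammaRing

theorem entryGrade_eq_gradeZ {Γ : Type u} (G : Gpd Γ) {D : Type v} [NonUnitalRing D]
    (DG : GammaRing G D) {I : Type w} (σ : I → Γ) (γ : Γ) (i j : I) :
    entryGrade G DG σ γ i j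
      = DG.gradeZ (G.of (σ i) * G.of γ * G.of (G.inv (σ j))) := by
  rw [← Gpd.of_conj]
  rfl

theorem GammaRing.GrRepMatrix.exists_matrixUnits {Γ : Type u} {G : Gpd Γ} {R : Type v} {D : Type x}
    [NonUnitalRing R] [NonUnitalRing D] {RG : GammaRing G R} {DG : GammaRing G D} {I : Type w}
    [Nonempty I] {σ : I → Γ} {e : Γ} (hdivD : DG.IsGrDivision) (hsupp : DG.SuppLE e)
    (he : G.IsObj e) (hσ : DFiniteSeq G e σ) (hR : RG.GrRepMatrix DG σ) :
    ∃ (e' : Γ) (u : R) (σ' : I → Γ) (x y : I → R), MatrixUnits RG e' u σ' x y ∧ u ≠ 0 ∧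
      ∀ γ, ∀ a ∈ RG.grade γ, a ≠ 0 → u * a = a → a * u = a → ∃ b, a * b = u := by
  classical
  obtain ⟨φ, hinj, hmul, himg⟩ := hR
  obtain ⟨o⟩ := ‹Nonempty I›
  have hentry : ∀ γ, ∀ r ∈ RG.grade γ, ∀ i j,
      φ r i j ∈ DG.gradeZ (G.of (σ i) * G.of γ * G.of (G.inv (σ j))) := by
    intro γ r hr i j
    have : φ r ∈ {m : I →₀ I →₀ D | ∀ i j : I, m i j ∈ entryGrade G DG σ γ i j} :=
      himg γ ▸ ⟨r, hr, rfl⟩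
    rw [← entryGrade_eq_gradeZ]
    exact this i j
  have hunit : ∀ i j d γ, d ∈ DG.gradeZ (G.of (σ i) * G.of γ * G.of (G.inv (σ j))) →
      ∃ r ∈ RG.grade γ, φ r = Finsupp.single i (Finsupp.single j d) := by
    intro i j d γ hd
    have : Finsupp.single i (Finsupp.single j d) ∈ (fun r : R => φ r) '' (RG.grade γ : Set R) := by
      rw [himg γ]
      intro k l
      by_cases hk : i = k
      · by_cases hl : j = l
        · subst hk hl
          rw [Finsupp.single_eq_same, Finsupp.single_eq_same, entryGrade_eq_gradeZ]
          exact hd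
        · rw [hk, Finsupp.single_eq_same, Finsupp.single_eq_of_ne' hl]
          exact zero_mem _
      · rw [Finsupp.single_eq_of_ne' hk]
        exact zero_mem _
    exact this
  have hleft : ∀ {a i j d}, φ a = Finsupp.single i (Finsupp.single j d) → ∀ r k l,
      φ (a * r) k l = Finsupp.single i (d * φ r j l) k := by
    intro a i j d ha r k l
    rw [hmul, ha, matMulEntry_single_left]
  have hright : ∀ {a i j d}, φ a = Finsupp.single i (Finsupp.single j d) → ∀ r k l,
      φ (r * a) k l = Finsupp.single j (φ r k i * d) l := by
    intro a i j d ha r k l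
    rw [hmul, ha, matMulEntry_single_right]
  have hsame : ∀ {a b i j k d d'}, φ a = Finsupp.single i (Finsupp.single j d) →
      φ b = Finsupp.single j (Finsupp.single k d') →
      φ (a * b) = Finsupp.single i (Finsupp.single k (d * d')) := by
    intro a b i j k d d' ha hb
    ext m l
    rw [hleft ha, hb, Finsupp.single_eq_same]
    by_cases hm : i = m
    · subst hm
      rw [Finsupp.single_eq_same, Finsupp.single_eq_same]
      by_cases hl : k = l
      · subst hl
        rw [Finsupp.single_eq_same, Finsupp.single_eq_same]
      · rw [Finsupp.single_eq_of_ne' hl, Finsupp.single_eq_of_ne' hl, mul_zero]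
    · rw [Finsupp.single_eq_of_ne' hm, Finsupp.single_eq_of_ne' hm, Finsupp.zero_apply]
  set ε := DG.one e with hε
  have hεε : ε * ε = ε := hsupp.one_mul ε
  have hε_mem : ε ∈ DG.gradeZ (G.of e) := DG.one_mem e he
  have hε0 : ε ≠ 0 := by
    obtain ⟨a, ha⟩ := hdivD.1
    intro h0
    rw [← hsupp.one_mul a, ← hε, h0, zero_mul] at ha
    exact ha rfl
  have htgt : ∀ i, G.tgt (σ o) = G.tgt (σ i) := fun i => (hσ.1 o).trans (hσ.1 i).symm
  let σ' : I → Γ := fun i => G.comp (G.inv (σ o)) (σ i) ((G.src_inv _).trans (htgt i))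
  have hσ' : ∀ i, G.of (σ' i) = G.of (G.inv (σ o)) * G.of (σ i) := fun i => (Gpd.of_mul_of _).symm
  have hσinv : ∀ i, G.of (G.inv (σ' i)) = G.of (G.inv (σ i)) * G.of (σ o) :=
    fun i => Gpd.of_inv_comp_inv (htgt i)
  have hee : G.of e * G.of e = G.of e := Gpd.of_mul_eq_right he.tgt_eq
  obtain ⟨u, hu, hφu⟩ := hunit o o ε (G.src (σ o)) (by
    rwa [G.of_mul_src, G.of_mul_inv, hσ.1])
  choose x hx hφx using fun i => hunit i o ε (G.inv (σ' i)) (by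
    rwa [hσinv, ← mul_assoc, G.of_mul_inv, mul_assoc, G.of_mul_inv, hσ.1, hσ.1, hee])
  choose y hy hφy using fun i => hunit o i ε (σ' i) (by
    rwa [hσ', ← mul_assoc, G.of_mul_inv, mul_assoc, G.of_mul_inv, hσ.1, hσ.1, hee])
  have hsrc : ∀ i, G.src (σ' i) = G.src (σ i) := fun i => G.src_comp _ _ _
  refine ⟨G.src (σ o), u, σ', x, y, ?_, ?_, ?_⟩
  · refine ⟨Gpd.isObj_src _, hu, fun i => (G.tgt_comp _ _ _).trans (G.tgt_inv _), ?_, hx, hy,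
      ?_, ?_, ?_, ?_, ?_⟩
    · simpa only [hsrc] using hσ.2
    · intro i
      apply hinj
      rw [hsame (hφx i) hφu, hφx, hεε]
    · intro i
      apply hinj
      rw [hsame hφu (hφy i), hφy, hεε]
    · intro i
      apply hinj
      rw [hsame (hφy i) (hφx i), hφu, hεε]
    · intro i j hij
      apply hinj
      ext k l
      rw [hleft (hφy i), hφx, Finsupp.single_eq_of_ne hij, Finsupp.zero_apply, mul_zero, map_zero,
        Finsupp.single_zero]
      rfl
    · intro f hf
      set s := Set.Finite.toFinset _ with hs
      have hmem : ∀ i, i ∈ s ↔ G.src (σ i) = f := fun i => by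
        rw [hs, Set.Finite.mem_toFinset, Set.mem_ofPred_eq, hsrc]
      have h₁ : (∑ i ∈ s, x i * y i) * RG.one f = ∑ i ∈ s, x i * y i := by
        rw [Finset.sum_mul]
        refine Finset.sum_congr rfl fun i hi => ?_
        rw [mul_assoc, GammaRing.mul_one_of_src ((hsrc i).trans ((hmem i).1 hi)) (hy i)]
      rw [← h₁]
      apply hinj
      ext k l
      rw [Finset.sum_mul, map_sum, Finsupp.finsetSum_apply, Finsupp.finsetSum_apply]
      simp_rw [hleft (hsame (hφx _) (hφy _)), hεε, hε, hsupp.one_mul]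
      by_cases hk : k ∈ s
      · rw [Finset.sum_eq_single k (fun i _ hi => Finsupp.single_eq_of_ne' hi)
          (fun h => absurd hk h), Finsupp.single_eq_same]
      · rw [Finset.sum_eq_zero fun i hi => Finsupp.single_eq_of_ne' fun h : i = k => hk (h ▸ hi)]
        have := hentry f _ (RG.one_mem f hf) k l
        rw [hf.mul_of_ne fun h => hk ((hmem k).2 h), zero_mul] at this
        exact this.symm
  · intro h0
    rw [h0, map_zero] at hφu
    have := DFunLike.congr_fun (DFunLike.congr_fun hφu o) o
    rw [Finsupp.single_eq_same, Finsupp.single_eq_same] at this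
    exact hε0 this.symm
  · intro γ a ha h0 hua hau
    have hφa : φ a = Finsupp.single o (Finsupp.single o (φ a o o)) := by
      ext k l
      rw [← hua, hleft hφu, hsupp.one_mul, ← hau, hright hφu, hsupp.mul_one, hau, hleft hφu,
        hsupp.one_mul, Finsupp.single_eq_same]
      by_cases hk : o = k
      · subst hk
        rw [Finsupp.single_eq_same, Finsupp.single_eq_same]
      · rw [Finsupp.single_eq_of_ne' hk, Finsupp.single_eq_of_ne' hk, Finsupp.zero_apply]
    have hd0 : φ a o o ≠ 0 := by
      intro h
      rw [h, Finsupp.single_zero, Finsupp.single_zero] at hφa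
      exact h0 (hinj (hφa.trans (map_zero φ).symm))
    obtain ⟨ζ, -, hζ⟩ := GammaRing.exists_of_mem_gradeZ_ne_zero (hentry γ a ha o o) hd0
    obtain ⟨d', hd', hdd', -⟩ := hdivD.2 ζ _ hζ hd0
    obtain ⟨hsζ, htζ⟩ := hsupp.src_tgt_eq hζ hd0
    obtain ⟨γ', hγ'⟩ := Gpd.exists_conj_eq (G := G) (a := σ o) (b := σ o) (ζ := G.inv ζ)
      (by rw [hσ.1, G.tgt_inv, hsζ]) (by rw [hσ.1, G.src_inv, htζ])
    obtain ⟨b, -, hφb⟩ := hunit o o d' γ' (by rw [hγ']; exact hd')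
    refine ⟨b, hinj ?_⟩
    rw [hsame hφa hφb, hdd', htζ, hφu]

namespace GammaRing

variable {Γ : Type u} {G : Gpd Γ} {R : Type v} [NonUnitalRing R] {RG : GammaRing G R}

theorem IsGrSimpleRing.exists_mul_mul_ne_zero (hS : RG.IsGrSimpleRing) {α β : Γ} {a b : R}
    (ha : a ∈ RG.grade α) (hb : b ∈ RG.grade β) (ha0 : a ≠ 0) (hb0 : b ≠ 0) :
    ∃ ρ, ∃ r ∈ RG.grade ρ, a * r * b ≠ 0 := by
  by_contra! h
  have h' : ∀ r, a * r * b = 0 := fun r => by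
    induction r using homogeneous_induction (RG := RG) with
    | zero => rw [mul_zero, zero_mul]
    | hom ρ r hr => exact h ρ r hr
    | add r s hr hs => rw [mul_add, add_mul, hr, hs, add_zero]
  let J := AddSubgroup.closure {z | ∃ r s, z = r * b * s}
  have hJ_mem : ∀ r s, r * b * s ∈ J := fun r s => AddSubgroup.subset_closure ⟨r, s, rfl⟩
  have hJ : RG.IsGradedIdeal J := by
    constructor
    · intro z hz t
      induction hz using AddSubgroup.closure_induction with
      | mem z hz =>
        obtain ⟨r, s, rfl⟩ := hz
        exact ⟨mul_assoc (r * b) s t ▸ hJ_mem r (s * t), by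
          rw [← mul_assoc, ← mul_assoc]; exact hJ_mem (t * r) s⟩
      | zero => rw [zero_mul, mul_zero]; exact ⟨zero_mem _, zero_mem _⟩
      | add x y _ _ hx hy =>
        rw [add_mul, mul_add]
        exact ⟨add_mem hx.1 hy.1, add_mem hx.2 hy.2⟩
      | neg x _ hx =>
        rw [neg_mul, mul_neg]
        exact ⟨neg_mem hx.1, neg_mem hx.2⟩
    · refine (AddSubgroup.closure_le _).2 ?_
      rintro _ ⟨r, s, rfl⟩
      rw [SetLike.mem_coe]
      induction r using homogeneous_induction (RG := RG) with
      | zero => rw [zero_mul, zero_mul]; exact zero_mem _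
      | add r t hr ht => rw [add_mul, add_mul]; exact add_mem hr ht
      | hom ρ r hr =>
      induction s using homogeneous_induction (RG := RG) with
      | zero => rw [mul_zero]; exact zero_mem _
      | add s t hs ht => rw [mul_add]; exact add_mem hs ht
      | hom τ s hs =>
        by_cases h0 : r * b * s = 0
        · rw [h0]; exact zero_mem _
        · obtain ⟨η, -, hη⟩ := exists_mul_mem_grade hr hb fun h => h0 (by rw [h, zero_mul])
          obtain ⟨θ, -, hθ⟩ := exists_mul_mem_grade hη hs h0
          exact AddSubgroup.mem_iSup_of_mem θ ⟨hθ, hJ_mem r s⟩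
  have hbJ : b ∈ J := by
    have := hJ_mem (RG.one (G.tgt β)) (RG.one (G.src β))
    rwa [RG.one_mul' β b hb, RG.mul_one' β b hb] at this
  have hJ_top : J = ⊤ := (hS.2 J hJ).resolve_left fun h =>
    hb0 (by rwa [h, AddSubgroup.mem_bot] at hbJ)
  have hker : J ≤ (AddMonoidHom.mulLeft a).ker := by
    refine (AddSubgroup.closure_le _).2 ?_
    rintro _ ⟨r, s, rfl⟩
    change a * (r * b * s) = 0
    rw [← mul_assoc, ← mul_assoc, h' r, zero_mul]
  refine ha0 ?_
  rw [← RG.mul_one' α a ha]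
  exact hker (hJ_top ▸ AddSubgroup.mem_top (RG.one (G.src α)))

theorem IsRightGamma0Artinian.wellFounded (hA : RG.IsRightGamma0Artinian) {e : Γ}
    (he : G.IsObj e) :
    WellFounded fun N P : {N // RG.regular.IsGradedSub N ∧ N ≤ RG.regular.eComp e} => N < P := by
  rw [wellFounded_iff_isEmpty_descending_chain]
  refine ⟨fun ⟨f, hf⟩ => ?_⟩
  obtain ⟨n, hn⟩ := hA e he (fun n => (f n).1) (fun n => (f n).2) fun n => (hf n).le
  exact (hf n).ne (Subtype.ext (hn (n + 1) n.le_succ))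

/-- `u` is a homogeneous idempotent of degree `e` such that `u R u` is a graded division ring. -/
structure IsDivisionCorner (RG : GammaRing G R) (e : Γ) (u : R) : Prop where
  isObj : G.IsObj e
  mem : u ∈ RG.grade e
  ne_zero : u ≠ 0
  idem : u * u = u
  exists_inv : ∀ γ, ∀ a ∈ RG.grade γ, a ≠ 0 → u * a = a → a * u = a →
    ∃ b ∈ RG.grade (G.inv γ), u * b = b ∧ b * u = b ∧ a * b = u ∧ b * a = u

theorem map_mulLeft_le_of_mem {N : AddSubgroup R} (hN : RG.regular.IsGradedSub N) {a : R}
    (ha : a ∈ N) (P : AddSubgroup R) : P.map (AddMonoidHom.mulLeft a) ≤ N := by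
  rintro _ ⟨r, -, rfl⟩
  exact hN.1 a ha r

theorem mem_eComp_of_mem {e γ : Γ} (h : G.tgt γ = e) {a : R} (ha : a ∈ RG.grade γ) :
    a ∈ RG.regular.eComp e :=
  AddSubgroup.mem_iSup_of_mem γ (AddSubgroup.mem_iSup_of_mem h ha)

theorem mul_mem_eComp {e : Γ} {a : R} (ha : a ∈ RG.regular.eComp e) (r : R) :
    a * r ∈ RG.regular.eComp e := by
  change a ∈ (RG.regular.eComp e).comap (AddMonoidHom.mulRight r)
  refine (iSup₂_le fun γ hγ a ha => ?_ : RG.regular.eComp e ≤ _) ha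
  change a * r ∈ RG.regular.eComp e
  induction r using homogeneous_induction (RG := RG) with
  | zero => rw [mul_zero]; exact zero_mem _
  | add r s hr hs => rw [mul_add]; exact add_mem hr hs
  | hom δ r hr =>
    by_cases h0 : a * r = 0
    · rw [h0]; exact zero_mem _
    · obtain ⟨η, hη, hmem⟩ := exists_mul_mem_grade ha hr h0
      exact mem_eComp_of_mem ((Gpd.tgt_of_mul hη).trans hγ) hmem

theorem map_mulLeft_le_eComp {e γ : Γ} (h : G.tgt γ = e) {a : R} (ha : a ∈ RG.grade γ)
    (P : AddSubgroup R) : P.map (AddMonoidHom.mulLeft a) ≤ RG.regular.eComp e := by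
  rintro _ ⟨r, -, rfl⟩
  exact mul_mem_eComp (mem_eComp_of_mem h ha) r

theorem IsRightGamma0Artinian.exists_isGrSimpleSub (hA : RG.IsRightGamma0Artinian)
    (h0 : ∃ a : R, a ≠ 0) :
    ∃ (e : Γ) (S : AddSubgroup R), G.IsObj e ∧ RG.regular.IsGrSimpleSub S ∧
      S ≤ RG.regular.eComp e := by
  obtain ⟨γ, a, ha, -, ha0⟩ := exists_homogeneous_of_ne_bot RG.regular.isGradedSub_top.2 fun h =>
    h0.elim fun a ha => ha ((AddSubgroup.eq_bot_iff_forall _).1 h a trivial)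
  have he := Gpd.isObj_tgt (G := G) γ
  have hwf := hA.wellFounded he
  let X : {N // RG.regular.IsGradedSub N ∧ N ≤ RG.regular.eComp (G.tgt γ)} :=
    ⟨(⊤ : AddSubgroup R).map (AddMonoidHom.mulLeft a),
      isGradedSub_map_mulLeft RG.regular.isGradedSub_top ha, map_mulLeft_le_eComp rfl ha _⟩
  have hX : X.1 ≠ ⊥ := fun h => ha0 ((AddSubgroup.eq_bot_iff_forall _).1 h a
    ⟨RG.one (G.src γ), trivial, RG.mul_one' γ a ha⟩)
  obtain ⟨S, hS0, hmin⟩ := hwf.has_min {N | N.1 ≠ ⊥} ⟨X, hX⟩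
  refine ⟨G.tgt γ, S.1, he, ⟨S.2.1, hS0, fun P hP hPS => ?_⟩, S.2.2⟩
  by_contra! h
  exact hmin ⟨P, hP, hPS.trans S.2.2⟩ h.1
    (lt_of_le_of_ne hPS fun heq => h.2 (congrArg Subtype.val heq))

theorem IsGrSimpleRing.exists_isDivisionCorner (hS : RG.IsGrSimpleRing)
    (hA : RG.IsRightGamma0Artinian) : ∃ e u, RG.IsDivisionCorner e u := by
  obtain ⟨e, S, he, hSs, hSe⟩ := hA.exists_isGrSimpleSub hS.1
  have hSg := isGradedSub_iff.1 hSs.1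
  have htgt : ∀ γ, ∀ a ∈ RG.grade γ, a ∈ S → a ≠ 0 → G.tgt γ = e := by
    intro γ a ha haS h0
    by_contra hne
    have : RG.regular.eComp e ≤ (RG.proj γ).ker := iSup₂_le fun δ hδ b hb =>
      proj_of_mem_ne (fun h : γ = δ => hne (by rw [h]; exact hδ)) hb
    have hz : RG.proj γ a = 0 := this (hSe haS)
    exact h0 (by rwa [proj_of_mem ha] at hz)
  have hsurj : ∀ γ, ∀ a ∈ RG.grade γ, a ∈ S → ∀ s ∈ S, a * s ≠ 0 →
      S.map (AddMonoidHom.mulLeft a) = S := by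
    intro γ a ha haS s hs h0
    refine (hSs.2.2 _ (isGradedSub_map_mulLeft hSs.1 ha)
      (map_mulLeft_le_of_mem hSs.1 haS S)).resolve_left fun h => h0 ?_
    exact (AddSubgroup.eq_bot_iff_forall _).1 h _ ⟨s, hs, rfl⟩
  have hinj : ∀ γ, ∀ a ∈ RG.grade γ, ∀ s ∈ S, a * s ≠ 0 → ∀ t ∈ S, a * t = 0 → t = 0 := by
    intro γ a ha s hs h0 t ht hat
    rcases hSs.2.2 _ (isGradedSub_inf_ker_mulLeft hSs.1 ha) inf_le_left with h | h
    · exact (AddSubgroup.eq_bot_iff_forall _).1 h t ⟨ht, hat⟩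
    · exact absurd (inf_eq_left.1 h hs) h0
  obtain ⟨α, x, hx, hxS, hx0⟩ := exists_homogeneous_of_ne_bot hSs.1.2 hSs.2.1
  obtain ⟨ρ, r, hr, hrx⟩ := hS.exists_mul_mul_ne_zero hx hx hx0 hx0
  obtain ⟨δ, -, hy⟩ := exists_mul_mem_grade hx hr fun h => hrx (by rw [h, zero_mul])
  set y := x * r
  have hyS : y ∈ S := hSs.1.1 x hxS r
  obtain ⟨s, hs, hys⟩ : y ∈ S.map (AddMonoidHom.mulLeft y) :=
    (hsurj δ y hy hyS x hxS hrx).symm ▸ hyS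
  replace hys : y * s = y := hys
  set u := RG.proj (G.src δ) s
  have huS : u ∈ S := hSg.2 s hs _
  have hu : u ∈ RG.grade (G.src δ) := proj_mem _ _
  have hyu : y * u = y := by
    rw [← proj_mul (G.of_mul_src δ) hy s, hys, proj_of_mem hy]
  have hy0 : y ≠ 0 := fun h => hrx (by rw [h, zero_mul])
  have hu0 : u ≠ 0 := fun h => hy0 (by rw [← hyu, h, mul_zero])
  have hδ : G.src δ = e := by
    rw [← htgt _ u hu huS hu0, G.tgt_src]
  rw [hδ] at hu
  have hleft : ∀ t ∈ S, u * t = t := by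
    intro t ht
    rw [← sub_eq_zero]
    refine hinj δ y hy x hxS hrx _ (sub_mem (hSs.1.1 u huS t) ht) ?_
    rw [mul_sub, ← mul_assoc, hyu, sub_self]
  have huu := hleft u huS
  refine ⟨e, u, he, hu, hu0, huu, fun γ a ha ha0 hua hau => ?_⟩
  have haS : a ∈ S := hua ▸ hSs.1.1 u huS a
  have hau0 : a * u ≠ 0 := by rwa [hau]
  have htγ := htgt γ a ha haS ha0
  have hsγ : G.src γ = e := by
    by_contra hne
    exact hau0 (RG.mul_ne _ _ (by rwa [he.tgt_eq]) _ _ ha hu)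
  obtain ⟨c, hc, hac⟩ : u ∈ S.map (AddMonoidHom.mulLeft a) :=
    (hsurj γ a ha haS u huS hau0).symm ▸ huS
  replace hac : a * c = u := hac
  set b := RG.proj (G.inv γ) c
  have hb : b ∈ RG.grade (G.inv γ) := proj_mem _ _
  have hbS : b ∈ S := hSg.2 c hc _
  have hab : a * b = u := by
    rw [← proj_mul (G.of_mul_inv γ) ha c, hac, htγ, proj_of_mem hu]
  have hba : b * a = u := by
    rw [← sub_eq_zero]
    refine hinj γ a ha u huS hau0 _ (sub_mem (hSs.1.1 b hbS a) huS) ?_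
    rw [mul_sub, ← mul_assoc, hab, hua, hau, sub_self]
  have hbu : b * u = b := by
    rw [← sub_eq_zero]
    refine hinj γ a ha u huS hau0 _ (sub_mem (hSs.1.1 b hbS u) hbS) ?_
    rw [mul_sub, ← mul_assoc, hab, huu, sub_self]
  exact ⟨b, hb, hleft b hbS, hbu, hab, hba⟩

/-- A homogeneous idempotent `w` of degree `f` is a finite sum of idempotents `x y` that are
equivalent to `u`. -/
theorem IsGrSimpleRing.exists_decomposition (hS : RG.IsGrSimpleRing)
    (hA : RG.IsRightGamma0Artinian) {e : Γ} {u : R} (hu : RG.IsDivisionCorner e u) {f : Γ}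
    (hf : G.IsObj f) {w : R} (hw : w ∈ RG.grade f) (hww : w * w = w) :
    ∃ s : Finset (R × R), ∑ p ∈ s, p.1 * p.2 = w ∧
      (∀ p ∈ s, ∃ γ, G.src γ = f ∧ G.tgt γ = e ∧ p.1 ∈ RG.grade (G.inv γ) ∧ p.2 ∈ RG.grade γ) ∧
      (∀ p ∈ s, p.1 * u = p.1 ∧ u * p.2 = p.2 ∧ w * p.1 = p.1 ∧ p.2 * w = p.2 ∧
        p.2 * p.1 = u) ∧
      ∀ p ∈ s, ∀ q ∈ s, p ≠ q → p.2 * q.1 = 0 := by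
  classical
  let X : ∀ w ∈ RG.grade f, {N // RG.regular.IsGradedSub N ∧ N ≤ RG.regular.eComp f} :=
    fun w hw => ⟨(⊤ : AddSubgroup R).map (AddMonoidHom.mulLeft w),
      isGradedSub_map_mulLeft RG.regular.isGradedSub_top hw, map_mulLeft_le_eComp hf.tgt_eq hw _⟩
  obtain ⟨N, hN⟩ : ∃ N, X w hw = N := ⟨_, rfl⟩
  induction N using (hA.wellFounded hf).induction generalizing w with
  | _ N ih =>
  by_cases hw0 : w = 0
  · subst hw0
    exact ⟨∅, by simp⟩
  obtain ⟨ρ, r, hr, hwru⟩ := hS.exists_mul_mul_ne_zero hw hu.mem hw0 hu.ne_zero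
  obtain ⟨η, hη, hwr⟩ := exists_mul_mem_grade hw hr fun h => hwru (by rw [h, zero_mul])
  obtain ⟨ξ, hξ, hx⟩ := exists_mul_mem_grade hwr hu.mem hwru
  set x := w * r * u
  have htξ : G.tgt ξ = f := by rw [Gpd.tgt_of_mul hξ, Gpd.tgt_of_mul hη, hf.tgt_eq]
  have hsξ : G.src ξ = e := by rw [Gpd.src_of_mul hξ, hu.isObj.src_eq]
  have hxu : x * u = x := by rw [mul_assoc, hu.idem]
  have hwx : w * x = x := by simp only [x, ← mul_assoc, hww]
  clear_value x
  obtain ⟨τ, t, ht, hutx⟩ := hS.exists_mul_mul_ne_zero hu.mem hx hu.ne_zero hwru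
  obtain ⟨θ, -, hut⟩ := exists_mul_mem_grade hu.mem ht fun h => hutx (by rw [h, zero_mul])
  obtain ⟨ζ, -, hd⟩ := exists_mul_mem_grade hut hx hutx
  obtain ⟨d, hdmem, hud, -, -, hdd⟩ := hu.exists_inv ζ _ hd hutx
    (by rw [← mul_assoc, ← mul_assoc, hu.idem]) (by rw [mul_assoc, hxu])
  set y := d * (u * t) * w
  have hyx : y * x = u := by
    rw [mul_assoc, hwx, mul_assoc, hdd]
  have hy0 : y ≠ 0 := fun h => hu.ne_zero (by rw [← hyx, h, zero_mul])
  have hdut0 : d * (u * t) ≠ 0 := fun h => hy0 (by simp only [y, h, zero_mul])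
  obtain ⟨κ, -, hdut⟩ := exists_mul_mem_grade hdmem hut hdut0
  obtain ⟨γ, -, hy⟩ := exists_mul_mem_grade hdut hw hy0
  have huy : u * y = y := by simp only [y, ← mul_assoc, hud]
  have hyw : y * w = y := by rw [mul_assoc, hww]
  change y ∈ RG.grade γ at hy
  clear_value y
  obtain ⟨ε, hε, hmem⟩ := exists_mul_mem_grade hy hx (by rw [hyx]; exact hu.ne_zero)
  obtain rfl : ε = e := eq_of_grade_ne (hyx ▸ hmem) hu.mem hu.ne_zero
  have htγ : G.tgt γ = ε := by rw [← Gpd.tgt_of_mul hε, hu.isObj.tgt_eq]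
  obtain rfl : γ = G.inv ξ := by
    rw [← htγ] at hε
    rw [Gpd.eq_inv_of_mul hε, G.inv_inv]
  have hxy : x * y ∈ RG.grade f := mul_mem_grade (by rw [G.of_mul_inv, htξ]) hx hy
  have hw' : w - x * y ∈ RG.grade f := sub_mem hw hxy
  have hw'x : (w - x * y) * x = 0 := by rw [sub_mul, hwx, mul_assoc, hyx, hxu, sub_self]
  have hyw' : y * (w - x * y) = 0 := by rw [mul_sub, hyw, ← mul_assoc, hyx, huy, sub_self]
  have hw'w' : (w - x * y) * (w - x * y) = w - x * y := by
    rw [mul_sub (w - x * y), ← mul_assoc, hw'x, zero_mul, sub_zero, sub_mul, hww, mul_assoc, hyw]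
  have hww' : w * (w - x * y) = w - x * y := by rw [mul_sub, hww, ← mul_assoc, hwx]
  have hw'w : (w - x * y) * w = w - x * y := by rw [sub_mul, hww, mul_assoc, hyw]
  have hlt : X (w - x * y) hw' < N := by
    subst hN
    refine lt_of_le_of_ne ?_ ?_
    · rintro _ ⟨a, -, rfl⟩
      exact ⟨(w - x * y) * a, trivial, by
        change w * ((w - x * y) * a) = (w - x * y) * a
        rw [← mul_assoc, hww']⟩
    · intro heq
      have hxmem : x ∈ (X w hw).1 := ⟨x, trivial, hwx⟩
      rw [← heq] at hxmem
      obtain ⟨a, -, ha⟩ := hxmem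
      replace ha : (w - x * y) * a = x := ha
      have : x = 0 := by rw [← ha, ← hw'w', mul_assoc, ha, hw'x]
      exact hwru this
  obtain ⟨s, hsum, hdeg, hrel, horth⟩ := ih _ hlt hw' hw'w' rfl
  have hyp : ∀ p ∈ s, y * p.1 = 0 := fun p hp => by
    rw [← (hrel p hp).2.2.1, ← mul_assoc, hyw', zero_mul]
  have hpx : ∀ p ∈ s, p.2 * x = 0 := fun p hp => by
    rw [← (hrel p hp).2.2.2.1, mul_assoc, hw'x, mul_zero]
  have hns : (x, y) ∉ s := fun h => hu.ne_zero (by rw [← hyx]; exact hyp _ h)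
  refine ⟨insert (x, y) s, ?_, ?_, ?_, ?_⟩
  · rw [Finset.sum_insert hns, hsum, add_sub_cancel]
  · refine Finset.forall_mem_insert _ _ _ |>.2 ⟨⟨G.inv ξ, ?_, ?_, ?_, hy⟩, hdeg⟩
    · rw [G.src_inv, htξ]
    · rw [G.tgt_inv, hsξ]
    · rwa [G.inv_inv]
  · refine Finset.forall_mem_insert _ _ _ |>.2 ⟨⟨hxu, huy, hwx, hyw, hyx⟩, fun p hp => ?_⟩
    obtain ⟨h₁, h₂, h₃, h₄, h₅⟩ := hrel p hp
    exact ⟨h₁, h₂, by rw [← h₃, ← mul_assoc, hww'], by rw [← h₄, mul_assoc, hw'w], h₅⟩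
  · intro p hp q hq hne
    rw [Finset.mem_insert] at hp hq
    rcases hp with rfl | hp <;> rcases hq with rfl | hq
    · exact absurd rfl hne
    · exact hyp q hq
    · exact hpx p hp
    · exact horth p hp q hq hne

end GammaRing

namespace GammaRing.IsDivisionCorner

variable {Γ : Type u} {G : Gpd Γ} {R : Type v} [NonUnitalRing R] {RG : GammaRing G R}
  {e : Γ} {u : R}

/-- The corner ring `u R u`. -/
def corner (_H : RG.IsDivisionCorner e u) : NonUnitalSubring R where
  carrier := {a | u * a = a ∧ a * u = a}
  zero_mem' := ⟨mul_zero u, zero_mul u⟩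
  add_mem' ha hb := ⟨by rw [mul_add, ha.1, hb.1], by rw [add_mul, ha.2, hb.2]⟩
  neg_mem' ha := ⟨by rw [mul_neg, ha.1], by rw [neg_mul, ha.2]⟩
  mul_mem' ha hb := ⟨by rw [← mul_assoc, ha.1], by rw [mul_assoc, hb.2]⟩

variable (H : RG.IsDivisionCorner e u)
include H

theorem self_mem_corner : u ∈ H.corner := ⟨H.idem, H.idem⟩

theorem mul_mul_mem_corner (r : R) : u * r * u ∈ H.corner :=
  ⟨by rw [← mul_assoc, ← mul_assoc, H.idem], by rw [mul_assoc, H.idem]⟩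

theorem mul_mul_mem_grade {γ : Γ} {r : R} (hr : r ∈ RG.grade γ) : u * r * u ∈ RG.grade γ := by
  by_cases ht : G.tgt γ = e
  · by_cases hs : G.src γ = e
    · exact mul_mem_grade (Gpd.of_mul_eq_left hs)
        (mul_mem_grade (Gpd.of_mul_eq_right ht) H.mem hr) H.mem
    · rw [mul_assoc, RG.mul_ne _ _ (by rwa [H.isObj.tgt_eq]) _ _ hr H.mem, mul_zero]
      exact zero_mem _
  · rw [RG.mul_ne _ _ (by rw [H.isObj.src_eq]; exact Ne.symm ht) _ _ H.mem hr, zero_mul]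
    exact zero_mem _

theorem src_tgt_eq {γ : Γ} {a : R} (ha : a ∈ RG.grade γ) (h0 : a ≠ 0) (hc : a ∈ H.corner) :
    G.src γ = e ∧ G.tgt γ = e := by
  constructor
  · by_contra hs
    exact h0 (by rw [← hc.2, RG.mul_ne _ _ (by rwa [H.isObj.tgt_eq]) _ _ ha H.mem])
  · by_contra ht
    exact h0 (by
      rw [← hc.1, RG.mul_ne _ _ (by rw [H.isObj.src_eq]; exact Ne.symm ht) _ _ H.mem ha])

/-- The grading on the corner ring `u R u` induced by the grading of `R`. -/
noncomputable def cornerGammaRing : GammaRing G H.corner where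
  grade γ := (RG.grade γ).comap (H.corner.subtype : H.corner →+ R)
  grade_iSup := by
    let p : R →+ H.corner :=
      { toFun := fun r => ⟨u * r * u, H.mul_mul_mem_corner r⟩
        map_zero' := Subtype.ext (by simp)
        map_add' := fun r s => Subtype.ext (by simp [mul_add, add_mul]) }
    have hp : ∀ r, p r ∈ ⨆ γ, (RG.grade γ).comap (H.corner.subtype : H.corner →+ R) := by
      intro r
      induction r using homogeneous_induction (RG := RG) with
      | zero => rw [map_zero]; exact zero_mem _
      | hom γ r hr => exact AddSubgroup.mem_iSup_of_mem γ (H.mul_mul_mem_grade hr)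
      | add r s hr hs => rw [map_add]; exact add_mem hr hs
    refine (AddSubgroup.eq_top_iff' _).2 fun a => ?_
    have ha : p a = a := Subtype.ext (by
      change u * a.1 * u = a.1
      rw [a.2.1, a.2.2])
    exact ha ▸ hp a
  grade_indep γ := by
    refine (AddSubgroup.eq_bot_iff_forall _).2 fun a ha => Subtype.ext ?_
    have hle : (⨆ (δ : Γ) (_ : δ ≠ γ), (RG.grade δ).comap (H.corner.subtype : H.corner →+ R)) ≤
        (⨆ (δ : Γ) (_ : δ ≠ γ), RG.grade δ).comap (H.corner.subtype : H.corner →+ R) :=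
      iSup₂_le fun δ hδ => AddSubgroup.comap_mono (le_iSup₂_of_le δ hδ le_rfl)
    exact (AddSubgroup.eq_bot_iff_forall _).1 (RG.grade_indep γ) a.1 ⟨ha.1, hle ha.2⟩
  mul_mem γ δ h a b ha hb := RG.mul_mem γ δ h a b ha hb
  mul_ne γ δ h a b ha hb := Subtype.ext (RG.mul_ne γ δ h a b ha hb)
  one f := by classical exact if f = e then ⟨u, H.self_mem_corner⟩ else 0
  one_mem f hf := by
    split_ifs with h
    · subst h
      exact H.mem
    · exact zero_mem _
  one_mul' γ a ha := by
    by_cases h0 : a = 0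
    · rw [h0, mul_zero]
    · rw [if_pos (H.src_tgt_eq ha (fun h => h0 (Subtype.ext h)) a.2).2]
      exact Subtype.ext a.2.1
  mul_one' γ a ha := by
    by_cases h0 : a = 0
    · rw [h0, zero_mul]
    · rw [if_pos (H.src_tgt_eq ha (fun h => h0 (Subtype.ext h)) a.2).1]
      exact Subtype.ext a.2.2

theorem cornerGammaRing_one : H.cornerGammaRing.one e = ⟨u, H.self_mem_corner⟩ :=
  if_pos rfl

theorem mem_gradeZ_cornerGammaRing {p : G.AdjoinZero} {a : H.corner} :
    a ∈ H.cornerGammaRing.gradeZ p ↔ (a : R) ∈ RG.gradeZ p := by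
  induction p using Gpd.adjoinZero_cases with
  | zero =>
    rw [gradeZ_zero, gradeZ_zero, AddSubgroup.mem_bot, AddSubgroup.mem_bot]
    exact ⟨congrArg Subtype.val, fun h => Subtype.ext h⟩
  | of γ => exact Iff.rfl

theorem suppLE_cornerGammaRing : H.cornerGammaRing.SuppLE e := by
  intro γ hγ
  obtain ⟨⟨a, ha⟩, h0⟩ := AddSubgroup.ne_bot_iff_exists_ne_zero.1 hγ
  exact H.src_tgt_eq ha (fun h => h0 (Subtype.ext (Subtype.ext h))) a.2

theorem isGrDivision_cornerGammaRing : H.cornerGammaRing.IsGrDivision := by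
  refine ⟨⟨⟨u, H.self_mem_corner⟩, fun h => H.ne_zero (congrArg Subtype.val h)⟩, ?_⟩
  intro γ a ha h0
  have h0' : (a : R) ≠ 0 := fun h => h0 (Subtype.ext h)
  obtain ⟨hs, ht⟩ := H.src_tgt_eq ha h0' a.2
  obtain ⟨b, hb, hub, hbu, hab, hba⟩ := H.exists_inv γ a ha h0' a.2.1 a.2.2
  refine ⟨⟨b, hub, hbu⟩, hb, ?_, ?_⟩
  · rw [ht, cornerGammaRing_one]
    exact Subtype.ext hab
  · rw [hs, cornerGammaRing_one]
    exact Subtype.ext hba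

/-- A system of matrix units with corner `u` identifies `R` with a graded matrix ring over
`u R u`. -/
theorem grRepMatrix {I : Type w} {σ : I → Γ} {x y : I → R} (hM : MatrixUnits RG e u σ x y) :
    RG.GrRepMatrix H.cornerGammaRing σ := by
  classical
  have hmem : ∀ r i j, y i * r * x j ∈ H.corner := fun r i j =>
    ⟨by rw [← mul_assoc, ← mul_assoc, hM.u_mul_y], by rw [mul_assoc, hM.x_mul_u]⟩
  let c : R → I → I → H.corner := fun r i j => ⟨y i * r * x j, hmem r i j⟩
  have hrow : ∀ r i, (Function.support (c r i)).Finite := by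
    intro r i
    obtain ⟨T, hT, -⟩ := hM.exists_finset_right r
    refine T.finite_toSet.subset fun j hj => ?_
    by_contra h
    exact hj (Subtype.ext (by change y i * r * x j = 0; rw [mul_assoc, hT j h, mul_zero]))
  let row : R → I → I →₀ H.corner := fun r i => Finsupp.ofSupportFinite (c r i) (hrow r i)
  have hcol : ∀ r, (Function.support (row r)).Finite := by
    intro r
    obtain ⟨T, hT, -⟩ := hM.exists_finset_left r
    refine T.finite_toSet.subset fun i hi => ?_
    by_contra h
    refine hi (Finsupp.ext fun j => Subtype.ext ?_)
    change y i * r * x j = 0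
    rw [hT i h, zero_mul]
  let φ : R →+ (I →₀ I →₀ H.corner) :=
    { toFun := fun r => Finsupp.ofSupportFinite (row r) (hcol r)
      map_zero' := by
        ext i j
        change y i * 0 * x j = 0
        rw [mul_zero, zero_mul]
      map_add' := by
        intro r s
        ext i j
        change y i * (r + s) * x j = y i * r * x j + y i * s * x j
        rw [mul_add, add_mul] }
  have hφ : ∀ r i j, ((φ r i j : H.corner) : R) = y i * r * x j := fun _ _ _ => rfl
  clear_value φ
  refine ⟨φ, ?_, ?_, ?_⟩
  · refine (injective_iff_map_eq_zero φ).2 fun r hr => ?_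
    refine hM.eq_zero_of_y_mul fun i => hM.eq_zero_of_mul_x fun j => ?_
    rw [← hφ, hr]
    rfl
  · intro a b i j
    obtain ⟨T, hT, hTa⟩ := hM.exists_finset_right a
    apply Subtype.ext
    have hsupp : (φ a i).support ⊆ T := by
      intro k hk
      by_contra h
      refine Finsupp.mem_support_iff.1 hk (Subtype.ext ?_)
      rw [hφ, mul_assoc, hT k h, mul_zero]
      rfl
    rw [matMulEntry, Finsupp.sum_of_support_subset (φ a i) hsupp (fun k d => d * φ b k j)
      fun _ _ => zero_mul _, hφ]
    change _ = (H.corner.subtype : H.corner →+ R) _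
    rw [map_sum]
    change _ = ∑ k ∈ T, (φ a i k : R) * (φ b k j : R)
    simp only [hφ]
    conv_lhs => rw [← hTa T subset_rfl]
    simp only [Finset.sum_mul, Finset.mul_sum, mul_assoc]
  · intro γ
    refine Set.Subset.antisymm ?_ ?_
    · rintro _ ⟨r, hr, rfl⟩ i j
      rw [entryGrade_eq_gradeZ, mem_gradeZ_cornerGammaRing, hφ]
      exact mul_mem_gradeZ (p := _ * _) (mul_mem_gradeZ (p := G.of (σ i)) (q := G.of γ)
        (hM.y_mem i) hr) (q := G.of _) (hM.x_mem j)
    · intro m hm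
      have hm' : ∀ i j, x i * (m i j : R) * y j ∈ RG.grade γ := by
        intro i j
        by_cases h0 : x i * (m i j : R) * y j = 0
        · rw [h0]; exact zero_mem _
        have hij := hm i j
        rw [entryGrade_eq_gradeZ, mem_gradeZ_cornerGammaRing] at hij
        have h := mul_mem_gradeZ (mul_mem_gradeZ (p := G.of _) (hM.x_mem i) hij)
          (q := G.of _) (hM.y_mem j)
        obtain ⟨η, hη, hmem⟩ := exists_of_mem_gradeZ_ne_zero h h0
        have hηγ : η = γ := by
          apply G.of_injective
          have hη' : G.of (G.src (σ i)) * G.of γ * G.of (G.src (σ j)) = G.of η := by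
            rw [← hη, ← G.of_inv_mul, ← G.of_inv_mul]
            simp only [mul_assoc]
          rw [← hη']
          have hi : G.tgt γ = G.src (σ i) := by
            by_contra hne
            rw [(Gpd.isObj_src _).of_mul_ne hne, zero_mul] at hη'
            exact G.of_ne_zero η hη'.symm
          rw [Gpd.of_mul_eq_right hi] at hη' ⊢
          exact Gpd.of_mul_eq_left ((Gpd.src_eq_tgt_of_mul hη').trans (G.tgt_src _))
        exact hηγ ▸ hmem
      let T : Finset I := m.support
      let T' : Finset I := T.biUnion fun i => (m i).support
      refine ⟨∑ i ∈ T, ∑ j ∈ T', x i * (m i j : R) * y j,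
        sum_mem fun i _ => sum_mem fun j _ => hm' i j, ?_⟩
      ext k l
      have hkey : ∀ i j, y k * (x i * (m i j : R) * y j) * x l
          = if i = k then if j = l then (m k l : R) else 0 else 0 := by
        intro i j
        split_ifs with h h'
        · subst h h'
          rw [← mul_assoc, ← mul_assoc, hM.y_mul_x, (m i j).2.1, mul_assoc, hM.y_mul_x,
            (m i j).2.2]
        · rw [mul_assoc, mul_assoc, hM.y_mul_x_ne j l h', mul_zero, mul_zero]
        · rw [← mul_assoc, ← mul_assoc, hM.y_mul_x_ne k i (Ne.symm h), zero_mul, zero_mul,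
            zero_mul]
      simp only [hφ, Finset.mul_sum, Finset.sum_mul, hkey]
      by_cases hk : k ∈ T
      · by_cases hl : l ∈ T'
        · simp [hk, hl]
        · have : m k l = 0 := by
            by_contra h
            exact hl (Finset.mem_biUnion.2 ⟨k, hk, Finsupp.mem_support_iff.2 h⟩)
          simp [this]
      · have : m k = 0 := Finsupp.notMem_support_iff.1 hk
        simp [this]

end GammaRing.IsDivisionCorner

/-- A graded simple, right artinian ring has matrix units over every division corner. -/
theorem GammaRing.IsDivisionCorner.exists_matrixUnits {Γ : Type u} {G : Gpd Γ} {R : Type v}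
    [NonUnitalRing R] {RG : GammaRing G R} (hS : RG.IsGrSimpleRing)
    (hA : RG.IsRightGamma0Artinian) {e : Γ} {u : R} (hu : RG.IsDivisionCorner e u) :
    ∃ (I : Type v) (σ : I → Γ) (x y : I → R), Nonempty I ∧ MatrixUnits RG e u σ x y := by
  classical
  have hdec : ∀ f, G.IsObj f → ∃ s : Finset (R × R), ∑ p ∈ s, p.1 * p.2 = RG.one f ∧
      (∀ p ∈ s, ∃ γ, G.src γ = f ∧ G.tgt γ = e ∧ p.1 ∈ RG.grade (G.inv γ) ∧ p.2 ∈ RG.grade γ) ∧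
      (∀ p ∈ s, p.1 * u = p.1 ∧ u * p.2 = p.2 ∧ RG.one f * p.1 = p.1 ∧ p.2 * RG.one f = p.2 ∧
        p.2 * p.1 = u) ∧ ∀ p ∈ s, ∀ q ∈ s, p ≠ q → p.2 * q.1 = 0 := fun f hf =>
    hS.exists_decomposition hA hu hf (RG.one_mem f hf)
      (GammaRing.one_mul_of_tgt hf.tgt_eq (RG.one_mem f hf))
  choose s hsum hdeg hrel horth using hdec
  let I := {p : R × R // ∃ f, ∃ hf : G.IsObj f, p ∈ s f hf}
  have hσ : ∀ p : I, ∃ γ, G.tgt γ = e ∧ p.1.1 ∈ RG.grade (G.inv γ) ∧ p.1.2 ∈ RG.grade γ ∧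
      p.1 ∈ s (G.src γ) (Gpd.isObj_src γ) := by
    rintro ⟨p, f, hf, hp⟩
    obtain ⟨γ, rfl, h⟩ := hdeg f hf p hp
    exact ⟨γ, h.1, h.2.1, h.2.2, hp⟩
  choose σ htgt hx hy hmem using hσ
  have hr := fun p : I => hrel _ _ p.1 (hmem p)
  have hsrc : ∀ f hf p, ∀ hp : p ∈ s f hf, G.src (σ ⟨p, f, hf, hp⟩) = f := by
    intro f hf p hp
    obtain ⟨γ, hγ, -, -, hp2⟩ := hdeg f hf p hp
    refine (congrArg G.src (GammaRing.eq_of_grade_ne (hy ⟨p, f, hf, hp⟩) hp2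
      fun h => hu.ne_zero ?_)).trans hγ
    rw [← (hrel f hf p hp).2.2.2.2, h, zero_mul]
  have hsubset : ∀ f (hf : G.IsObj f), {p : I | G.src (σ p) = f} ⊆
      Subtype.val ⁻¹' (s f hf : Set (R × R)) := by
    rintro f hf p rfl
    exact hmem p
  have hfin : ∀ f, {p : I | G.src (σ p) = f}.Finite := by
    intro f
    by_cases hf : G.IsObj f
    · exact ((s f hf).finite_toSet.preimage Subtype.val_injective.injOn).subset (hsubset f hf)
    · refine Set.finite_empty.subset ?_
      rintro p rfl
      exact hf (Gpd.isObj_src _)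
  have hM : MatrixUnits RG e u σ (fun p => p.1.1) fun p => p.1.2 := by
    refine ⟨hu.isObj, hu.mem, htgt, hfin, hx, hy, fun p => (hr p).1, fun p => (hr p).2.1,
      fun p => (hr p).2.2.2.2, fun p q hpq => ?_, fun f hf => ?_⟩
    · by_cases h : G.src (σ p) = G.src (σ q)
      · have hq : q.1 ∈ s (G.src (σ p)) (Gpd.isObj_src _) := by
          simpa only [h] using hmem q
        exact horth _ _ _ (hmem p) _ hq fun h' => hpq (Subtype.ext h')
      · exact RG.mul_ne _ _ (by rwa [G.tgt_inv]) _ _ (hy p) (hx q)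
    · rw [← hsum f hf]
      refine Finset.sum_bij (fun p _ => p.1) ?_ (fun p _ q _ h => Subtype.ext h) ?_
        fun _ _ => rfl
      · intro p hp
        exact hsubset f hf ((hfin f).mem_toFinset.1 hp)
      · intro p hp
        exact ⟨⟨p, f, hf, hp⟩, (hfin f).mem_toFinset.2 (hsrc f hf p hp), rfl⟩
  refine ⟨I, σ, _, _, ?_, hM⟩
  by_contra hI
  rw [not_nonempty_iff] at hI
  obtain ⟨a, ha⟩ := hS.1
  exact ha (hM.eq_zero_of_mul_x fun i => hI.elim i)

/-- graded Wedderburn–Artin for gr-simple rings.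
Let `Γ` be a groupoid and `R` an object unital `Γ`-graded ring.  Then `R` is a
gr-simple ring that is right `Γ₀`-artinian if and only if there exist an object
`e₀ ∈ Γ₀`, a `Γ`-graded division ring `D` with `supp D ⊆ e₀Γe₀`, a nonempty set `I`
and a `d`-finite sequence `σ̄ = (σ_i)_{i∈I}` of elements of `e₀Γ` such that
`R ≅_gr M_I(D)(σ̄)`. -/
theorem grSimple_gamma0Artinian_iff_matrix_ring_over_graded_division_ring
    {Γ : Type u} (G : Gpd Γ) {R : Type v} [NonUnitalRing R] (RG : GammaRing G R) :
    (RG.IsGrSimpleRing ∧ RG.IsRightGamma0Artinian) ↔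
      ∃ (e₀ : Γ) (D : BRing.{u, v} G) (I : Type v) (σ : I → Γ),
        G.IsObj e₀ ∧ Nonempty I ∧ D.str.IsGrDivision ∧ D.str.SuppLE e₀ ∧
          DFiniteSeq G e₀ σ ∧ RG.GrRepMatrix D.str σ := by
  constructor
  · rintro ⟨hS, hA⟩
    obtain ⟨e, u, hu⟩ := hS.exists_isDivisionCorner hA
    obtain ⟨I, σ, x, y, hI, hM⟩ := hu.exists_matrixUnits hS hA
    exact ⟨e, ⟨hu.corner, hu.cornerGammaRing⟩, I, σ, hu.isObj, hI, hu.isGrDivision_cornerGammaRing,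
      hu.suppLE_cornerGammaRing, ⟨hM.tgt, hM.fin⟩, hu.grRepMatrix hM⟩
  · rintro ⟨e, D, I, σ, he, hI, hdiv, hsupp, hσ, hR⟩
    obtain ⟨e', u, σ', x, y, hM, hu0, hu⟩ := hR.exists_matrixUnits hdiv hsupp he hσ
    exact ⟨hM.isGrSimpleRing hu0 hu, hM.isRightGamma0Artinian hu0 hu⟩
end

section
/- Let Γ be a groupoid and R a right gr-semisimple object unital Γ-graded ring. Let 𝒮(R) be the set of isoshift classes of gr-simple Γ-graded right R-modules and, for j ∈ 𝒮(R), let R_j be the isoshiftical component of R of type j. Then: (1) R_j is a nonzero graded ideal of R for each j ∈ 𝒮(R); (2) {R_j : j ∈ 𝒮(R)} is a summable family of Γ-graded rings and R = ∏^gr_{j∈𝒮(R)} R_j; (3) each R_j is a gr-simple right Γ₀-artinian ring. -/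
set_option autoImplicit false

universe u v w x y

namespace Gpd

variable {Γ : Type u} (G : Gpd Γ)

theorem id_comp_of_eq {η γ : Γ} (hη : η = G.tgt γ)
    (hc : G.src η = G.tgt γ) : G.comp η γ hc = γ := by
  subst hη
  exact G.id_comp γ

theorem comp_left_cancel {σ γ δ : Γ} (h : G.src σ = G.tgt γ)
    (h' : G.src σ = G.tgt δ) (e : G.comp σ γ h = G.comp σ δ h') : γ = δ := by
  have key : ∀ (ε : Γ) (h : G.src σ = G.tgt ε),
      G.comp (G.inv σ) (G.comp σ ε h) ((G.src_inv σ).trans (G.tgt_comp σ ε h).symm) = ε := by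
    intro ε h
    rw [← G.comp_assoc (G.inv σ) σ ε (G.src_inv σ) h]
    exact G.id_comp_of_eq ((G.inv_comp σ).trans h) _
  have h1 := key γ h
  have h2 := key δ h'
  simp only [e] at h1
  exact h1.symm.trans h2

end Gpd

namespace GammaMod

open DirectSum

variable {Γ : Type u} {G : Gpd Γ} {R : Type v} [NonUnitalRing R] {RG : GammaRing G R}
  {M : Type w} [AddCommGroup M] (Mod : GammaMod RG M)

theorem isInternal_grade [DecidableEq Γ] : DirectSum.IsInternal Mod.grade := by
  refine ⟨iSupIndep.dfinsuppSumAddHom_injective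
    fun γ => disjoint_iff.2 (Mod.grade_indep γ), ?_⟩
  rw [← AddMonoidHom.range_eq_top, eq_top_iff, ← Mod.grade_iSup]
  exact iSup_le fun γ m hm => ⟨DirectSum.of (fun γ => Mod.grade γ) γ ⟨m, hm⟩,
    DirectSum.coeAddMonoidHom_of Mod.grade γ ⟨m, hm⟩⟩

open scoped Classical in
/-- The projection of `M` onto its homogeneous component of degree `γ`. -/
noncomputable def proj (γ : Γ) : M →+ M :=
  letI := Mod.isInternal_grade.chooseDecomposition
  AddMonoidHom.mk' (fun m => (decompose Mod.grade m γ : M)) (by simp)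

theorem proj_mem (γ : Γ) (m : M) : Mod.proj γ m ∈ Mod.grade γ :=
  SetLike.coe_mem _

theorem proj_of_mem {γ : Γ} {m : M} (hm : m ∈ Mod.grade γ) : Mod.proj γ m = m := by
  classical
  let := Mod.isInternal_grade.chooseDecomposition
  exact decompose_of_mem_same Mod.grade hm

theorem proj_of_mem_ne {γ δ : Γ} {m : M} (hm : m ∈ Mod.grade δ) (h : δ ≠ γ) :
    Mod.proj γ m = 0 := by
  classical
  let := Mod.isInternal_grade.chooseDecomposition
  exact decompose_of_mem_ne Mod.grade hm h

theorem exists_sum_proj (m : M) : ∃ s : Finset Γ, ∑ γ ∈ s, Mod.proj γ m = m := by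
  classical
  let := Mod.isInternal_grade.chooseDecomposition
  exact ⟨_, sum_support_decompose Mod.grade m⟩

variable {Mod}

theorem exists_proj_ne_zero (Mod : GammaMod RG M) {m : M} (hm : m ≠ 0) :
    ∃ γ, Mod.proj γ m ≠ 0 := by
  by_contra! h
  obtain ⟨s, hs⟩ := Mod.exists_sum_proj m
  exact hm (by rw [← hs]; simp [h])

theorem ext_proj (Mod : GammaMod RG M) {m n : M} (h : ∀ γ, Mod.proj γ m = Mod.proj γ n) :
    m = n := by
  rw [← sub_eq_zero]
  by_contra hne
  obtain ⟨γ, hγ⟩ := Mod.exists_proj_ne_zero hne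
  exact hγ (by simp [h])

theorem IsGradedSub.proj_mem {N : AddSubgroup M} (hN : Mod.IsGradedSub N) (γ : Γ) {m : M}
    (hm : m ∈ N) : Mod.proj γ m ∈ N := by
  have h : (⨆ γ : Γ, (Mod.grade γ ⊓ N)) ≤ N.comap (Mod.proj γ) := by
    refine iSup_le fun δ n hn => ?_
    rw [AddSubgroup.mem_comap]
    by_cases hδ : δ = γ
    · subst hδ
      rw [Mod.proj_of_mem hn.1]
      exact hn.2
    · rw [Mod.proj_of_mem_ne hn.1 hδ]
      exact N.zero_mem
  exact h (hN.2 hm)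

theorem le_iSup_grade_inf (Mod : GammaMod RG M) {N : AddSubgroup M}
    (h : ∀ γ, ∀ m ∈ N, Mod.proj γ m ∈ N) :
    N ≤ ⨆ γ : Γ, (Mod.grade γ ⊓ N) := by
  intro m hm
  obtain ⟨s, hs⟩ := Mod.exists_sum_proj m
  rw [← hs]
  exact AddSubgroup.sum_mem _ fun γ _ =>
    (le_iSup (fun γ => Mod.grade γ ⊓ N) γ) ⟨Mod.proj_mem γ m, h γ m hm⟩

theorem isGradedSub_iff {N : AddSubgroup M} : Mod.IsGradedSub N ↔
    (∀ m ∈ N, ∀ a, Mod.smul m a ∈ N) ∧ ∀ γ, ∀ m ∈ N, Mod.proj γ m ∈ N :=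
  ⟨fun h => ⟨h.1, fun γ _ hm => h.proj_mem γ hm⟩, fun h => ⟨h.1, Mod.le_iSup_grade_inf h.2⟩⟩

/-- Scalar multiplication as an additive map in the module argument. -/
def smulRight (Mod : GammaMod RG M) (a : R) : M →+ M :=
  AddMonoidHom.mk' (fun m => Mod.smul m a) fun m n => Mod.add_smul m n a

/-- Scalar multiplication as an additive map in the ring argument. -/
def smulLeft (Mod : GammaMod RG M) (m : M) : R →+ M :=
  AddMonoidHom.mk' (fun a => Mod.smul m a) fun a b => Mod.smul_add m a b

theorem IsGradedSub.inf {N P : AddSubgroup M} (hN : Mod.IsGradedSub N)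
    (hP : Mod.IsGradedSub P) : Mod.IsGradedSub (N ⊓ P) :=
  isGradedSub_iff.2 ⟨fun m hm a => ⟨hN.1 m hm.1 a, hP.1 m hm.2 a⟩,
    fun γ _ hm => ⟨hN.proj_mem γ hm.1, hP.proj_mem γ hm.2⟩⟩

theorem isGradedSub_iSup {ι : Sort*} {N : ι → AddSubgroup M}
    (hN : ∀ i, Mod.IsGradedSub (N i)) : Mod.IsGradedSub (⨆ i, N i) := by
  refine isGradedSub_iff.2 ⟨fun m hm a => ?_, fun γ m hm => ?_⟩
  · have h : (⨆ i, N i) ≤ (⨆ i, N i).comap (Mod.smulRight a) :=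
      iSup_le fun i n hn => le_iSup N i ((hN i).1 n hn a)
    exact h hm
  · have h : (⨆ i, N i) ≤ (⨆ i, N i).comap (Mod.proj γ) :=
      iSup_le fun i n hn => le_iSup N i ((hN i).proj_mem γ hn)
    exact h hm

theorem mem_eComp {e γ : Γ} (hγ : G.tgt γ = e) {m : M} (hm : m ∈ Mod.grade γ) :
    m ∈ Mod.eComp e :=
  AddSubgroup.mem_iSup_of_mem γ (AddSubgroup.mem_iSup_of_mem hγ hm)

theorem isGradedSub_eComp (Mod : GammaMod RG M) (e : Γ) : Mod.IsGradedSub (Mod.eComp e) := by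
  refine isGradedSub_iff.2 ⟨fun m hm a => ?_, fun γ m hm => ?_⟩
  · have h : Mod.eComp e ≤ (Mod.eComp e).comap (Mod.smulRight a) := by
      refine iSup₂_le fun γ hγ (m : M) hm => ?_
      obtain ⟨s, hs⟩ := RG.regular.exists_sum_proj a
      change Mod.smulLeft m a ∈ Mod.eComp e
      rw [← hs, map_sum]
      refine AddSubgroup.sum_mem _ fun δ _ => ?_
      have hδ : RG.regular.proj δ a ∈ RG.grade δ := RG.regular.proj_mem δ a
      change Mod.smul m (RG.regular.proj δ a) ∈ Mod.eComp e
      by_cases hc : G.src γ = G.tgt δ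
      · exact mem_eComp ((G.tgt_comp γ δ hc).trans hγ) (Mod.smul_mem γ δ hc m _ hm hδ)
      · rw [Mod.smul_ne γ δ hc m _ hm hδ]
        exact AddSubgroup.zero_mem _
    exact h hm
  · have h : Mod.eComp e ≤ (Mod.eComp e).comap (Mod.proj γ) := by
      refine iSup₂_le fun δ hδ (m : M) hm => ?_
      rw [AddSubgroup.mem_comap]
      by_cases hc : δ = γ
      · subst hc
        rw [Mod.proj_of_mem hm]
        exact mem_eComp hδ hm
      · rw [Mod.proj_of_mem_ne hm hc]
        exact AddSubgroup.zero_mem _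
    exact h hm

theorem tgt_eq_of_mem_eComp {γ e : Γ} {m : M} (hm : m ∈ Mod.grade γ) (h0 : m ≠ 0)
    (he : m ∈ Mod.eComp e) : G.tgt γ = e := by
  by_contra h
  have hle : Mod.eComp e ≤ (Mod.proj γ).ker := by
    refine iSup₂_le fun δ hδ n hn => ?_
    rw [AddMonoidHom.mem_ker, Mod.proj_of_mem_ne hn]
    rintro rfl
    exact h hδ
  have := hle he
  rw [AddMonoidHom.mem_ker, Mod.proj_of_mem hm] at this
  exact h0 this

theorem IsGrSimpleSub.le_of_mem {N P : AddSubgroup M} (hN : Mod.IsGrSimpleSub N)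
    (hP : Mod.IsGradedSub P) {m : M} (hmN : m ∈ N) (hmP : m ∈ P) (h0 : m ≠ 0) : N ≤ P := by
  rcases hN.2.2 (N ⊓ P) (hN.1.inf hP) inf_le_left with h | h
  · exact absurd (h ▸ ⟨hmN, hmP⟩ : m ∈ (⊥ : AddSubgroup M)) h0
  · exact inf_eq_left.1 h

theorem IsGrSimpleSub.tgt_eq {N : AddSubgroup M} (hN : Mod.IsGrSimpleSub N) {γ δ : Γ}
    {m n : M} (hm : m ∈ Mod.grade γ) (hn : n ∈ Mod.grade δ) (hmN : m ∈ N) (hnN : n ∈ N)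
    (hm0 : m ≠ 0) (hn0 : n ≠ 0) : G.tgt γ = G.tgt δ :=
  (tgt_eq_of_mem_eComp hn hn0 (hN.le_of_mem (Mod.isGradedSub_eComp _) hmN
    (mem_eComp rfl hm) hm0 hnN)).symm

theorem mem_shiftGrade {σ γ : Γ} {m : M} :
    m ∈ Mod.shiftGrade σ γ ↔ m = 0 ∨ ∃ h : G.src σ = G.tgt γ, m ∈ Mod.grade (G.comp σ γ h) := by
  unfold shiftGrade Gpd.mul?
  split_ifs with h
  · simp only [Option.elim_some, h, exists_true_left]
    exact ⟨Or.inr, fun hm => hm.elim (fun h0 => h0 ▸ AddSubgroup.zero_mem _) id⟩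
  · simp [h]

theorem isGrSimple_iff : Mod.IsGrSimple ↔ (∃ m : M, m ≠ 0) ∧
    ∀ P : AddSubgroup M, Mod.IsGradedSub P → P = ⊥ ∨ P = ⊤ := by
  refine ⟨fun h => ⟨?_, fun P hP => h.2.2 P hP le_top⟩, fun h => ⟨Mod.isGradedSub_top, ?_,
    fun P hP _ => h.2 P hP⟩⟩
  · obtain ⟨m, -, hm⟩ := (AddSubgroup.bot_or_exists_ne_zero _).resolve_left h.2.1
    exact ⟨m, hm⟩
  · obtain ⟨m, hm⟩ := h.1
    exact fun h => hm (AddSubgroup.mem_bot.1 (h ▸ AddSubgroup.mem_top m))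

theorem IsGrSimple.exists_homogeneous (hM : Mod.IsGrSimple) :
    ∃ γ, ∃ m ∈ Mod.grade γ, m ≠ 0 := by
  obtain ⟨⟨m, hm⟩, -⟩ := isGrSimple_iff.1 hM
  obtain ⟨γ, hγ⟩ := Mod.exists_proj_ne_zero hm
  exact ⟨γ, _, Mod.proj_mem γ m, hγ⟩

section Shift

variable {N : Type x} [AddCommGroup N] {L : Type y} [AddCommGroup L]

/-- `f` is a homomorphism of graded modules `M → N(σ)`. -/
def IsShiftHom (A : GammaMod RG M) (B : GammaMod RG N) (σ : Γ) (f : M →+ N) : Prop :=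
  (∀ m a, f (A.smul m a) = B.smul (f m) a) ∧
    ∀ γ, ∀ m ∈ A.grade γ, f m ∈ B.shiftGrade σ γ

/-- There is a gr-isomorphism `M ≅ N(σ)` for some `σ`. -/
def ShiftIso (A : GammaMod RG M) (B : GammaMod RG N) : Prop :=
  ∃ (σ : Γ) (ψ : M ≃+ N), (∀ m a, ψ (A.smul m a) = B.smul (ψ m) a) ∧
    ∀ γ m, ψ m ∈ B.shiftGrade σ γ ↔ m ∈ A.grade γ

variable {A : GammaMod RG M} {B : GammaMod RG N} {C : GammaMod RG L}

theorem IsShiftHom.proj_comp {σ γ : Γ} {f : M →+ N} (hf : IsShiftHom A B σ f)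
    (h : G.src σ = G.tgt γ) (m : M) :
    B.proj (G.comp σ γ h) (f m) = f (A.proj γ m) := by
  have key : (⊤ : AddSubgroup M) ≤
      ((B.proj (G.comp σ γ h)).comp f).eqLocus (f.comp (A.proj γ)) := by
    rw [← A.grade_iSup]
    refine iSup_le fun δ m hm => ?_
    change B.proj (G.comp σ γ h) (f m) = f (A.proj γ m)
    have hfm := hf.2 δ m hm
    rw [mem_shiftGrade] at hfm
    by_cases hδ : δ = γ
    · subst hδ
      rw [A.proj_of_mem hm]
      rcases hfm with h0 | ⟨_, h1⟩
      · rw [h0, map_zero]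
      · exact B.proj_of_mem h1
    · rw [A.proj_of_mem_ne hm hδ, map_zero]
      rcases hfm with h0 | ⟨h', h1⟩
      · rw [h0, map_zero]
      · exact B.proj_of_mem_ne h1 fun e => hδ (G.comp_left_cancel h' h e)
  exact key (AddSubgroup.mem_top m)

theorem IsShiftHom.isGradedSub_ker {σ : Γ} {f : M →+ N} (hf : IsShiftHom A B σ f) :
    A.IsGradedSub f.ker := by
  refine isGradedSub_iff.2 ⟨fun m hm a => ?_, fun γ m hm => ?_⟩
  · rw [AddMonoidHom.mem_ker] at hm ⊢
    rw [hf.1, hm]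
    exact map_zero (B.smulRight a)
  · rw [AddMonoidHom.mem_ker] at hm ⊢
    rcases mem_shiftGrade.1 (hf.2 γ _ (A.proj_mem γ m)) with h | ⟨h, -⟩
    · exact h
    · rw [← hf.proj_comp h, hm, map_zero]

theorem IsShiftHom.isGradedSub_range {σ : Γ} {f : M →+ N} (hf : IsShiftHom A B σ f) :
    B.IsGradedSub f.range := by
  refine isGradedSub_iff.2 ⟨?_, ?_⟩
  · rintro _ ⟨m, rfl⟩ a
    exact ⟨A.smul m a, hf.1 m a⟩
  · rintro δ _ ⟨m, rfl⟩
    obtain ⟨s, hs⟩ := A.exists_sum_proj m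
    rw [← hs, map_sum, map_sum]
    refine AddSubgroup.sum_mem _ fun γ _ => ?_
    rcases mem_shiftGrade.1 (hf.2 γ _ (A.proj_mem γ m)) with h | ⟨h, hm⟩
    · rw [h, map_zero]
      exact AddSubgroup.zero_mem _
    · by_cases hδ : G.comp σ γ h = δ
      · subst hδ
        rw [B.proj_of_mem hm]
        exact ⟨_, rfl⟩
      · rw [B.proj_of_mem_ne hm hδ]
        exact AddSubgroup.zero_mem _

/-- Schur's lemma: a nonzero graded homomorphism between gr-simple modules is bijective. -/
theorem IsShiftHom.shiftIso {σ : Γ} {f : M →+ N} (hf : IsShiftHom A B σ f)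
    (hA : A.IsGrSimple) (hB : B.IsGrSimple) {m₀ : M} (h0 : f m₀ ≠ 0) : ShiftIso A B := by
  have hker : f.ker = ⊥ := ((isGrSimple_iff.1 hA).2 _ hf.isGradedSub_ker).resolve_right
    fun h => h0 (AddMonoidHom.mem_ker.1 (h ▸ AddSubgroup.mem_top m₀))
  have hrange : f.range = ⊤ := ((isGrSimple_iff.1 hB).2 _ hf.isGradedSub_range).resolve_left
    fun h => h0 (AddSubgroup.mem_bot.1 (h ▸ ⟨m₀, rfl⟩))
  have hinj : Function.Injective f := (AddMonoidHom.ker_eq_bot_iff f).1 hker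
  have hbij : Function.Bijective f := ⟨hinj, AddMonoidHom.range_eq_top.1 hrange⟩
  refine ⟨σ, AddEquiv.ofBijective f hbij, hf.1,
    fun γ m => ⟨fun hm => ?_, hf.2 γ m⟩⟩
  rcases mem_shiftGrade.1 hm with h | ⟨h, hm⟩
  · rw [AddEquiv.ofBijective_apply] at h
    rw [hinj (h.trans (map_zero f).symm)]
    exact AddSubgroup.zero_mem _
  · have e := hf.proj_comp h m
    rw [AddEquiv.ofBijective_apply] at hm
    rw [B.proj_of_mem hm] at e
    rw [hinj e]
    exact A.proj_mem γ m

theorem ShiftIso.symm (hA : A.IsGrSimple) (hB : B.IsGrSimple) (h : ShiftIso A B) :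
    ShiftIso B A := by
  obtain ⟨σ, ψ, hlin, hgr⟩ := h
  obtain ⟨δ, m, hm, hm0⟩ := hA.exists_homogeneous
  have hψ0 : ψ m ≠ 0 := fun h => hm0 (ψ.map_eq_zero_iff.1 h)
  obtain ⟨hσδ, hψm⟩ := (mem_shiftGrade.1 ((hgr δ m).2 hm)).resolve_left hψ0
  refine IsShiftHom.shiftIso (σ := G.inv σ) (f := ψ.symm.toAddMonoidHom) ⟨fun n a => ?_,
    fun γ n hn => ?_⟩ hB hA (m₀ := ψ m) (by simpa using hm0)
  · apply ψ.injective
    rw [hlin]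
    simp
  · rw [mem_shiftGrade, or_iff_not_imp_left]
    intro hn0
    have hn0' : n ≠ 0 := by
      rintro rfl
      exact hn0 (map_zero _)
    have htgt : G.tgt σ = G.tgt γ := by
      rw [← G.tgt_comp σ δ hσδ]
      exact IsGrSimpleSub.tgt_eq hB hψm hn trivial trivial hψ0 hn0'
    have hc : G.src (G.inv σ) = G.tgt γ := (G.src_inv σ).trans htgt
    refine ⟨hc, (hgr _ _).1 ?_⟩
    rw [mem_shiftGrade]
    right
    have hd : G.src σ = G.tgt (G.comp (G.inv σ) γ hc) :=
      ((G.tgt_comp _ _ _).trans (G.tgt_inv σ)).symm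
    refine ⟨hd, ?_⟩
    have e : G.comp σ (G.comp (G.inv σ) γ hc) hd = γ := by
      rw [← G.comp_assoc σ (G.inv σ) γ (G.tgt_inv σ).symm hc]
      exact G.id_comp_of_eq ((G.comp_inv σ).trans htgt) _
    rw [e]
    simpa using hn

theorem ShiftIso.trans (hA : A.IsGrSimple) (hC : C.IsGrSimple) (h : ShiftIso A B)
    (h' : ShiftIso B C) : ShiftIso A C := by
  obtain ⟨σ, ψ, hlin, hgr⟩ := h
  obtain ⟨τ, φ, hlin', hgr'⟩ := h'
  have key : ∀ γ, ∀ m ∈ A.grade γ, m ≠ 0 → ∃ (h : G.src σ = G.tgt γ)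
      (h' : G.src τ = G.tgt (G.comp σ γ h)), φ (ψ m) ∈ C.grade (G.comp τ (G.comp σ γ h) h') := by
    intro γ m hm h0
    have hψ0 : ψ m ≠ 0 := fun h => h0 (ψ.map_eq_zero_iff.1 h)
    have hφ0 : φ (ψ m) ≠ 0 := fun h => hψ0 (φ.map_eq_zero_iff.1 h)
    obtain ⟨h, hψm⟩ := (mem_shiftGrade.1 ((hgr γ m).2 hm)).resolve_left hψ0
    obtain ⟨h', hφm⟩ := (mem_shiftGrade.1 ((hgr' _ _).2 hψm)).resolve_left hφ0
    exact ⟨h, h', hφm⟩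
  obtain ⟨δ, m, hm, hm0⟩ := hA.exists_homogeneous
  obtain ⟨h1, h2, -⟩ := key δ m hm hm0
  have hτσ : G.src τ = G.tgt σ := h2.trans (G.tgt_comp _ _ _)
  refine IsShiftHom.shiftIso (σ := G.comp τ σ hτσ)
    (f := φ.toAddMonoidHom.comp ψ.toAddMonoidHom) ⟨fun n a => ?_, fun γ n hn => ?_⟩ hA hC
    (m₀ := m) fun h => hm0 (ψ.map_eq_zero_iff.1 (φ.map_eq_zero_iff.1 h))
  · simp [hlin, hlin']
  · rw [mem_shiftGrade, or_iff_not_imp_left]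
    intro hn0
    have hn0' : n ≠ 0 := by
      rintro rfl
      exact hn0 (map_zero _)
    obtain ⟨h, h', hmem⟩ := key γ n hn hn0'
    refine ⟨(G.src_comp _ _ _).trans h, ?_⟩
    rw [G.comp_assoc τ σ γ hτσ h]
    exact hmem

theorem shiftIso_refl (hA : A.IsGrSimple) : ShiftIso A A := by
  obtain ⟨δ, m, hm, hm0⟩ := hA.exists_homogeneous
  refine IsShiftHom.shiftIso (σ := G.tgt δ) (f := AddMonoidHom.id M) ⟨fun n a => rfl,
    fun γ n hn => ?_⟩ hA hA (m₀ := m) hm0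
  rw [mem_shiftGrade, or_iff_not_imp_left]
  intro hn0
  have htgt : G.tgt δ = G.tgt γ := IsGrSimpleSub.tgt_eq hA hm hn trivial trivial hm0 hn0
  refine ⟨(G.src_tgt δ).trans htgt, ?_⟩
  rw [G.id_comp_of_eq htgt]
  exact hn

end Shift

section Sub

variable {N : AddSubgroup M}

/-- A graded submodule, as a graded module in its own right. -/
def sub (hN : Mod.IsGradedSub N) : GammaMod RG N where
  smul n a := ⟨Mod.smul n a, hN.1 n n.2 a⟩
  smul_add n a b := Subtype.ext (Mod.smul_add n a b)
  add_smul m n a := Subtype.ext (Mod.add_smul m n a)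
  smul_mul m a b := Subtype.ext (Mod.smul_mul m a b)
  grade γ := (Mod.grade γ).addSubgroupOf N
  grade_iSup := by
    refine eq_top_iff.2 fun n _ => ?_
    have h : (⨆ γ : Γ, (Mod.grade γ ⊓ N)) ≤
        (⨆ γ : Γ, (Mod.grade γ).addSubgroupOf N).map N.subtype :=
      iSup_le fun γ m hm => ⟨⟨m, hm.2⟩, AddSubgroup.mem_iSup_of_mem γ hm.1, rfl⟩
    obtain ⟨n', hn', e⟩ := h (hN.2 n.2)
    rwa [← Subtype.ext (a1 := n') (a2 := n) e]
  grade_indep γ := by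
    refine eq_bot_iff.2 fun n hn => ?_
    have h : (⨆ (δ : Γ) (_ : δ ≠ γ), (Mod.grade δ).addSubgroupOf N) ≤
        (⨆ (δ : Γ) (_ : δ ≠ γ), Mod.grade δ).comap N.subtype :=
      iSup₂_le fun δ hδ m hm =>
        AddSubgroup.mem_iSup_of_mem δ (AddSubgroup.mem_iSup_of_mem hδ hm)
    have h0 : (n : M) ∈ (⊥ : AddSubgroup M) := Mod.grade_indep γ ▸ ⟨hn.1, h hn.2⟩
    exact AddSubgroup.mem_bot.2 (Subtype.ext (AddSubgroup.mem_bot.1 h0))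
  smul_mem σ τ h m a hm ha := Mod.smul_mem σ τ h m a hm ha
  smul_ne σ τ h m a hm ha := Subtype.ext (Mod.smul_ne σ τ h m a hm ha)
  smul_one σ m hm := Subtype.ext (Mod.smul_one σ m hm)

theorem IsGrSimpleSub.sub (hN : Mod.IsGrSimpleSub N) : (Mod.sub hN.1).IsGrSimple := by
  obtain ⟨m, hm, h0⟩ := (AddSubgroup.bot_or_exists_ne_zero _).resolve_left hN.2.1
  refine isGrSimple_iff.2 ⟨⟨⟨m, hm⟩, fun h => h0 (congrArg Subtype.val h)⟩, fun P hP => ?_⟩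
  have hP' : Mod.IsGradedSub (P.map N.subtype) := by
    refine ⟨?_, ?_⟩
    · rintro _ ⟨p, hp, rfl⟩ a
      exact ⟨_, hP.1 p hp a, rfl⟩
    · rintro _ ⟨p, hp, rfl⟩
      have h : (⨆ γ : Γ, ((Mod.sub hN.1).grade γ ⊓ P)) ≤
          (⨆ γ : Γ, (Mod.grade γ ⊓ P.map N.subtype)).comap N.subtype :=
        iSup_le fun γ q hq => AddSubgroup.mem_iSup_of_mem γ ⟨hq.1, q, hq.2, rfl⟩
      exact h (hP.2 hp)
  rcases hN.2.2 _ hP' (AddSubgroup.map_subtype_le P) with h | h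
  · left
    exact (AddSubgroup.map_eq_bot_iff_of_injective P N.subtype_injective).1 h
  · right
    refine eq_top_iff.2 fun n _ => ?_
    obtain ⟨p, hp, e⟩ : (n : M) ∈ P.map N.subtype := by
      rw [h]
      exact n.2
    rwa [← Subtype.ext (a1 := p) (a2 := n) e]

variable {L : Type y} [AddCommGroup L]

theorem subIso_top_iff {B : GammaMod RG L} (hN : Mod.IsGradedSub N) :
    Mod.SubIso B N ⊤ hN ↔ ShiftIso (Mod.sub hN) B := by
  constructor
  · rintro ⟨σ, ψ, hlin, hgr⟩
    refine ⟨σ, ψ.trans AddSubgroup.topEquiv, hlin, fun γ n => ⟨fun hn => ?_, fun hn => ?_⟩⟩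
    · obtain ⟨n', hn', e⟩ : ((ψ n : (⊤ : AddSubgroup L)) : L) ∈
          (fun n : N => ((ψ n : (⊤ : AddSubgroup L)) : L)) '' {n : N | (n : M) ∈ Mod.grade γ} := by
        rw [hgr γ]
        exact ⟨trivial, hn⟩
      rwa [← ψ.injective (Subtype.ext e)]
    · have : ((ψ n : (⊤ : AddSubgroup L)) : L) ∈
          {m : L | m ∈ (⊤ : AddSubgroup L) ∧ m ∈ B.shiftGrade σ γ} := by
        rw [← hgr γ]
        exact ⟨n, hn, rfl⟩
      exact this.2
  · rintro ⟨σ, ψ, hlin, hgr⟩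
    refine ⟨σ, ψ.trans AddSubgroup.topEquiv.symm, hlin, fun γ => Set.ext fun m => ⟨?_, ?_⟩⟩
    · rintro ⟨n, hn, rfl⟩
      exact ⟨trivial, (hgr γ n).2 hn⟩
    · rintro ⟨-, hm⟩
      exact ⟨ψ.symm m, (hgr γ _).1 (by simpa using hm), by simp⟩

theorem shiftIso_sub_top_iff {B : GammaMod RG L} (hN : Mod.IsGradedSub ⊤) :
    ShiftIso (Mod.sub hN) B ↔ ShiftIso Mod B := by
  constructor
  · rintro ⟨σ, ψ, hlin, hgr⟩
    exact ⟨σ, AddSubgroup.topEquiv.symm.trans ψ, fun m a => hlin ⟨m, trivial⟩ a,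
      fun γ m => hgr γ ⟨m, trivial⟩⟩
  · rintro ⟨σ, ψ, hlin, hgr⟩
    exact ⟨σ, AddSubgroup.topEquiv.trans ψ, fun m a => hlin m a, fun γ m => hgr γ m⟩

end Sub

end GammaMod

theorem bmodSameClass_iff {Γ : Type u} {G : Gpd Γ} {R : Type v} [NonUnitalRing R]
    {RG : GammaRing G R} {S T : BMod.{u, v, w} RG} :
    BModSameClass S T ↔ GammaMod.ShiftIso S.str T.str :=
  (GammaMod.subIso_top_iff _).trans (GammaMod.shiftIso_sub_top_iff _)

namespace GammaRing

open GammaMod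

variable {Γ : Type u} {G : Gpd Γ} {R : Type v} [NonUnitalRing R] {RG : GammaRing G R}

theorem mem_isoComponent {S : BMod.{u, v, w} RG} {N : AddSubgroup R}
    (hN : RG.regular.IsGrSimpleSub N) (h : ShiftIso (RG.regular.sub hN.1) S.str) {x : R}
    (hx : x ∈ N) : x ∈ RG.isoComponent S :=
  AddSubgroup.mem_iSup_of_mem N
    (AddSubgroup.mem_iSup_of_mem ⟨hN, hN.1, (subIso_top_iff hN.1).2 h⟩ hx)

theorem isoComponent_le {S : BMod.{u, v, w} RG} {P : AddSubgroup R}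
    (h : ∀ (N : AddSubgroup R) (hN : RG.regular.IsGrSimpleSub N),
      ShiftIso (RG.regular.sub hN.1) S.str → N ≤ P) : RG.isoComponent S ≤ P :=
  iSup₂_le fun N hN => h N hN.1 (hN.2.elim fun h => (subIso_top_iff h).1)

theorem isGradedSub_isoComponent (S : BMod.{u, v, w} RG) :
    RG.regular.IsGradedSub (RG.isoComponent S) :=
  isGradedSub_iSup fun _ => isGradedSub_iSup fun h => h.1.1

theorem isoComponent_mono {S T : BMod.{u, v, w} RG} (hT : T.str.IsGrSimple)
    (h : ShiftIso S.str T.str) : RG.isoComponent S ≤ RG.isoComponent T :=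
  isoComponent_le fun _ hN hNS _ => mem_isoComponent hN (hNS.trans hN.sub hT h)

theorem mul_eq_zero_of_not_shiftIso {N N' : AddSubgroup R} (hN : RG.regular.IsGrSimpleSub N)
    (hN' : RG.regular.IsGrSimpleSub N')
    (h : ¬ ShiftIso (RG.regular.sub hN'.1) (RG.regular.sub hN.1))
    {x y : R} (hx : x ∈ N) (hy : y ∈ N') : x * y = 0 := by
  obtain ⟨s, hs⟩ := RG.regular.exists_sum_proj x
  rw [← hs, Finset.sum_mul]
  refine Finset.sum_eq_zero fun γ _ => ?_
  by_contra h0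
  have hxγ := hN.1.proj_mem γ hx
  refine h (IsShiftHom.shiftIso (σ := γ) (m₀ := ⟨y, hy⟩)
    (f := AddMonoidHom.mk' (fun n : N' =>
      (⟨RG.regular.proj γ x * n, hN.1.1 _ hxγ n⟩ : N))
      fun m n => Subtype.ext (mul_add _ (m : R) (n : R)))
    ⟨fun n a => Subtype.ext (mul_assoc _ _ _).symm, fun δ n hn => ?_⟩
    hN'.sub hN.sub fun h => h0 (congrArg Subtype.val h))
  rw [mem_shiftGrade]
  by_cases hc : G.src γ = G.tgt δ
  · exact Or.inr ⟨hc, RG.mul_mem γ δ hc _ _ (RG.regular.proj_mem γ x) hn⟩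
  · exact Or.inl (Subtype.ext (RG.mul_ne γ δ hc _ _ (RG.regular.proj_mem γ x) hn))

theorem isoComponent_mul_eq_zero {S T : BMod.{u, v, w} RG} (hS : S.str.IsGrSimple)
    (hT : T.str.IsGrSimple) (h : ¬ ShiftIso T.str S.str) {x y : R}
    (hx : x ∈ RG.isoComponent S) (hy : y ∈ RG.isoComponent T) : x * y = 0 := by
  have h1 : RG.isoComponent S ≤ (AddMonoidHom.mulRight y).ker := by
    refine isoComponent_le fun N hN hNS x hx => ?_
    have h2 : RG.isoComponent T ≤ (AddMonoidHom.mulLeft x).ker := by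
      refine isoComponent_le fun N' hN' hNT y hy => ?_
      refine mul_eq_zero_of_not_shiftIso hN hN' (fun hiso => h ?_) hx hy
      exact (hNT.symm hN'.sub hT).trans hT hS (hiso.trans hN'.sub hS hNS)
    exact h2 hy
  exact h1 hx

/-- A graded right ideal, as a bundled graded module. -/
def bmod {N : AddSubgroup R} (hN : RG.regular.IsGradedSub N) : BMod.{u, v, v} RG :=
  ⟨N, RG.regular.sub hN⟩

theorem iSup_isoComponent (hss : RG.IsRightGrSemisimple) :
    (⨆ (S : BMod.{u, v, v} RG) (_ : S.str.IsGrSimple), RG.isoComponent S) = ⊤ := by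
  rw [eq_top_iff, ← show _ = ⊤ from hss]
  exact iSup₂_le fun N hN x hx => AddSubgroup.mem_iSup_of_mem (bmod hN.1)
    (AddSubgroup.mem_iSup_of_mem hN.sub (mem_isoComponent hN (shiftIso_refl hN.sub) hx))

theorem le_of_isoComponent_le (hss : RG.IsRightGrSemisimple) {P : AddSubgroup R}
    (h : ∀ S : BMod.{u, v, v} RG, S.str.IsGrSimple → RG.isoComponent S ≤ P) (x : R) :
    x ∈ P := by
  have := iSup₂_le h
  rw [iSup_isoComponent hss] at this
  exact this (AddSubgroup.mem_top x)

theorem mul_mem_of_isoComponent (hss : RG.IsRightGrSemisimple) {S : BMod.{u, v, v} RG}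
    (hS : S.str.IsGrSimple) {P : AddSubgroup R} {x : R} (hx : x ∈ RG.isoComponent S)
    (h : ∀ y ∈ RG.isoComponent S, x * y ∈ P) (y : R) : x * y ∈ P := by
  refine le_of_isoComponent_le hss (P := P.comap (AddMonoidHom.mulLeft x))
    (fun T hT y hy => ?_) y
  by_cases hTS : ShiftIso T.str S.str
  · exact h y (isoComponent_mono hS hTS hy)
  · change x * y ∈ P
    rw [isoComponent_mul_eq_zero hS hT hTS hx hy]
    exact P.zero_mem

theorem mul_mem_of_isoComponent' (hss : RG.IsRightGrSemisimple) {S : BMod.{u, v, v} RG}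
    (hS : S.str.IsGrSimple) {P : AddSubgroup R} {x : R} (hx : x ∈ RG.isoComponent S)
    (h : ∀ y ∈ RG.isoComponent S, y * x ∈ P) (y : R) : y * x ∈ P := by
  refine le_of_isoComponent_le hss (P := P.comap (AddMonoidHom.mulRight x))
    (fun T hT y hy => ?_) y
  by_cases hTS : ShiftIso T.str S.str
  · exact h y (isoComponent_mono hS hTS hy)
  · change y * x ∈ P
    rw [isoComponent_mul_eq_zero hT hS (fun h => hTS (h.symm hS hT)) hy hx]
    exact P.zero_mem

theorem isGradedIdeal_isoComponent (hss : RG.IsRightGrSemisimple) {S : BMod.{u, v, v} RG}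
    (hS : S.str.IsGrSimple) : RG.IsGradedIdeal (RG.isoComponent S) :=
  have h := isGradedSub_isoComponent S
  ⟨fun x hx r => ⟨h.1 x hx r,
    mul_mem_of_isoComponent' hss hS hx (fun y hy => h.1 y hy x) r⟩, h.2⟩

theorem isoComponent_ne_bot (hss : RG.IsRightGrSemisimple) {S : BMod.{u, v, w} RG}
    (hS : S.str.IsGrSimple) : RG.isoComponent S ≠ ⊥ := by
  obtain ⟨σ, m, hm, hm0⟩ := hS.exists_homogeneous
  have key : ∃ N, RG.regular.IsGrSimpleSub N ∧ ∃ y ∈ N, S.str.smul m y ≠ 0 := by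
    by_contra! h
    have hle : (⊤ : AddSubgroup R) ≤ (S.str.smulLeft m).ker := by
      rw [← show _ = ⊤ from hss]
      exact iSup₂_le fun N hN y hy => h N hN y hy
    exact hm0 ((S.str.smul_one σ m hm).symm.trans (hle (AddSubgroup.mem_top _)))
  obtain ⟨N, hN, y, hy, hy0⟩ := key
  have hiso : ShiftIso (RG.regular.sub hN.1) S.str := by
    refine IsShiftHom.shiftIso (σ := σ) (m₀ := ⟨y, hy⟩)
      (f := (S.str.smulLeft m).comp N.subtype) ⟨fun n a => S.str.smul_mul m n a,
      fun δ n hn => ?_⟩ hN.sub hS hy0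
    rw [mem_shiftGrade]
    by_cases hc : G.src σ = G.tgt δ
    · exact Or.inr ⟨hc, S.str.smul_mem σ δ hc _ _ hm hn⟩
    · exact Or.inl (S.str.smul_ne σ δ hc _ _ hm hn)
  intro h
  obtain ⟨z, hz, hz0⟩ := (AddSubgroup.bot_or_exists_ne_zero _).resolve_left hN.2.1
  exact hz0 (AddSubgroup.mem_bot.1 (h ▸ mem_isoComponent hN hiso hz))

theorem proj_mul_one (γ : Γ) (z : R) :
    RG.regular.proj γ (z * RG.one (G.src γ)) = RG.regular.proj γ z := by
  have h : (⊤ : AddSubgroup R) ≤ ((RG.regular.proj γ).comp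
      (AddMonoidHom.mulRight (RG.one (G.src γ)))).eqLocus (RG.regular.proj γ) := by
    rw [← RG.grade_iSup]
    refine iSup_le fun δ z hz => ?_
    change RG.regular.proj γ (z * RG.one (G.src γ)) = RG.regular.proj γ z
    by_cases hδ : G.src δ = G.src γ
    · rw [← hδ, RG.mul_one' δ z hz]
    · rw [RG.mul_ne δ (G.src γ) (by rwa [G.tgt_src]) z _ hz (RG.one_mem _ (G.src_src γ)),
        map_zero, RG.regular.proj_of_mem_ne hz]
      rintro rfl
      exact hδ rfl
  exact h (AddSubgroup.mem_top z)

theorem eq_zero_of_mul_eq_zero (RG : GammaRing G R) {z : R} (h : ∀ r, z * r = 0) : z = 0 := by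
  refine RG.regular.ext_proj fun γ => ?_
  rw [← proj_mul_one, h]

theorem one_mul_of_mem_eComp {e : Γ} {x : R} (hx : x ∈ RG.regular.eComp e) :
    RG.one e * x = x := by
  have h : RG.regular.eComp e ≤
      (AddMonoidHom.mulLeft (RG.one e)).eqLocus (AddMonoidHom.id R) := by
    refine iSup₂_le fun γ hγ (y : R) hy => ?_
    change RG.one e * y = y
    rw [← hγ]
    exact RG.one_mul' γ y hy
  exact h hx

theorem isoComponent_inf_iSup (hss : RG.IsRightGrSemisimple) {S : BMod.{u, v, v} RG}
    (hS : S.str.IsGrSimple) : RG.isoComponent S ⊓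
      (⨆ (T : BMod.{u, v, v} RG) (_ : T.str.IsGrSimple ∧ ¬ ShiftIso S.str T.str),
        RG.isoComponent T) = ⊥ := by
  refine eq_bot_iff.2 fun z hz => AddSubgroup.mem_bot.2 (RG.eq_zero_of_mul_eq_zero fun r => ?_)
  refine AddSubgroup.mem_bot.1 (mul_mem_of_isoComponent hss hS hz.1 (fun r hr => ?_) r)
  have h : (⨆ (T : BMod.{u, v, v} RG) (_ : T.str.IsGrSimple ∧ ¬ ShiftIso S.str T.str),
        RG.isoComponent T) ≤ (AddMonoidHom.mulRight r).ker :=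
    iSup₂_le fun T hT x hx => isoComponent_mul_eq_zero hT.1 hS hT.2 hx hr
  exact h hz.2

theorem exists_list_shiftIso (hss : RG.IsRightGrSemisimple) (x : R) :
    ∃ l : List (BMod.{u, v, v} RG), ∀ S : BMod.{u, v, v} RG, S.str.IsGrSimple →
      ∀ z ∈ RG.isoComponent S, x * z ≠ 0 → ∃ T ∈ l, ShiftIso S.str T.str := by
  let P : AddSubgroup R :=
    { carrier := {x | ∃ l : List (BMod.{u, v, v} RG), ∀ S : BMod.{u, v, v} RG,
        S.str.IsGrSimple → ∀ z ∈ RG.isoComponent S, x * z ≠ 0 →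
          ∃ T ∈ l, ShiftIso S.str T.str}
      zero_mem' := ⟨[], fun S _ z _ h => absurd (zero_mul z) h⟩
      add_mem' := by
        rintro x y ⟨l, hl⟩ ⟨l', hl'⟩
        refine ⟨l ++ l', fun S hS z hz h => ?_⟩
        by_cases hx : x * z = 0
        · rw [add_mul, hx, zero_add] at h
          obtain ⟨T, hT, hST⟩ := hl' S hS z hz h
          exact ⟨T, List.mem_append_right _ hT, hST⟩
        · obtain ⟨T, hT, hST⟩ := hl S hS z hz hx
          exact ⟨T, List.mem_append_left _ hT, hST⟩
      neg_mem' := by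
        rintro x ⟨l, hl⟩
        exact ⟨l, fun S hS z hz h => hl S hS z hz fun h0 => h (by rw [neg_mul, h0, neg_zero])⟩ }
  refine le_of_isoComponent_le hss (P := P) (fun T hT x hx => ⟨[T], fun S hS z hz h => ?_⟩) x
  by_contra h'
  exact h (isoComponent_mul_eq_zero hT hS (fun hST => h' ⟨T, by simp, hST⟩) hx hz)

end GammaRing

namespace GammaMod

variable {Γ : Type u} {G : Gpd Γ} {R : Type v} [NonUnitalRing R] {RG : GammaRing G R}
  {M : Type w} [AddCommGroup M] (Mod : GammaMod RG M)

/-- The ring of additive endomorphisms preserving all graded submodules.  The submodules of `M`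
over this ring are the graded submodules of `M`. -/
def gradedEnd : Subring (AddMonoid.End M) where
  carrier := {f | ∀ N, Mod.IsGradedSub N → ∀ m ∈ N, f m ∈ N}
  mul_mem' hf hg N hN m hm := hf N hN _ (hg N hN m hm)
  one_mem' _ _ _ hm := hm
  add_mem' hf hg N hN m hm := N.add_mem (hf N hN m hm) (hg N hN m hm)
  zero_mem' N _ _ _ := N.zero_mem
  neg_mem' hf N hN m hm := N.neg_mem (hf N hN m hm)

variable {Mod}

/-- A graded submodule, as a submodule over `gradedEnd`. -/
def IsGradedSub.toSubmodule {N : AddSubgroup M} (hN : Mod.IsGradedSub N) :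
    Submodule Mod.gradedEnd M :=
  { N with smul_mem' := fun f m hm => f.2 N hN m hm }

theorem isGradedSub_toAddSubgroup (p : Submodule Mod.gradedEnd M) :
    Mod.IsGradedSub p.toAddSubgroup :=
  isGradedSub_iff.2
    ⟨fun _ hm a => p.smul_mem ⟨Mod.smulRight a, fun _ hN m hm => hN.1 m hm a⟩ hm,
      fun γ _ hm => p.smul_mem ⟨Mod.proj γ, fun _ hN _ hm => hN.proj_mem γ hm⟩ hm⟩

theorem isGrSimpleSub_iff_isAtom {p : Submodule Mod.gradedEnd M} :
    Mod.IsGrSimpleSub p.toAddSubgroup ↔ IsAtom p := by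
  have hbot : ∀ q : Submodule Mod.gradedEnd M, q.toAddSubgroup = ⊥ ↔ q = ⊥ := fun q =>
    Submodule.toAddSubgroup_inj q ⊥
  constructor
  · rintro ⟨-, h0, h⟩
    refine ⟨fun hp => h0 ((hbot p).2 hp), fun q hq => (hbot q).1 ?_⟩
    refine (h _ (isGradedSub_toAddSubgroup q) hq.le).resolve_right fun e => hq.ne ?_
    exact Submodule.toAddSubgroup_injective e
  · rintro ⟨h0, h⟩
    refine ⟨isGradedSub_toAddSubgroup p, fun hp => h0 ((hbot p).1 hp), fun P hP hle => ?_⟩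
    rcases (show hP.toSubmodule ≤ p from hle).eq_or_lt with e | hlt
    · exact Or.inr (congrArg Submodule.toAddSubgroup e)
    · exact Or.inl ((hbot _).2 (h _ hlt))

theorem IsGrSemisimple.isSemisimpleModule (h : Mod.IsGrSemisimple) :
    IsSemisimpleModule Mod.gradedEnd M := by
  refine IsSemisimpleModule.of_sSup_simples_eq_top (eq_top_iff.2 ?_)
  have hle : (⨆ (N : AddSubgroup M) (_ : Mod.IsGrSimpleSub N), N) ≤
      (sSup {p : Submodule Mod.gradedEnd M | IsSimpleModule Mod.gradedEnd p}).toAddSubgroup :=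
    iSup₂_le fun N hN => show hN.1.toSubmodule ≤ _ from le_sSup
      (isSimpleModule_iff_isAtom.2 (isGrSimpleSub_iff_isAtom.1 hN))
  rw [show _ = ⊤ from h] at hle
  exact hle

theorem IsGrSemisimple.exists_simple_le (h : Mod.IsGrSemisimple) {N : AddSubgroup M}
    (hN : Mod.IsGradedSub N) (h0 : N ≠ ⊥) : ∃ P ≤ N, Mod.IsGrSimpleSub P := by
  have := h.isSemisimpleModule
  rcases IsSemisimpleModule.eq_bot_or_exists_simple_le hN.toSubmodule with e | ⟨p, hp, hs⟩
  · exact absurd (congrArg Submodule.toAddSubgroup e) h0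
  · exact ⟨p.toAddSubgroup, hp, isGrSimpleSub_iff_isAtom.2 (isSimpleModule_iff_isAtom.1 hs)⟩

theorem IsGrSemisimple.exists_complement (h : Mod.IsGrSemisimple) {N : AddSubgroup M}
    (hN : Mod.IsGradedSub N) : ∃ P, Mod.IsGradedSub P ∧ N ⊓ P = ⊥ ∧ N ⊔ P = ⊤ := by
  have := h.isSemisimpleModule
  obtain ⟨p, hp⟩ := exists_isCompl hN.toSubmodule
  refine ⟨p.toAddSubgroup, isGradedSub_toAddSubgroup p,
    congrArg Submodule.toAddSubgroup hp.inf_eq_bot, ?_⟩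
  have := congrArg Submodule.toAddSubgroup hp.sup_eq_top
  rwa [Submodule.sup_toAddSubgroup] at this

end GammaMod

namespace GammaRing

open GammaMod

variable {Γ : Type u} {G : Gpd Γ} {R : Type v} [NonUnitalRing R] {RG : GammaRing G R}

theorem isRightGamma0Artinian (hss : RG.IsRightGrSemisimple) :
    RG.IsRightGamma0Artinian := by
  intro e he f hf hanti
  have : IsSemisimpleModule RG.regular.gradedEnd R :=
    IsGrSemisimple.isSemisimpleModule (Mod := RG.regular) hss
  let E : Submodule RG.regular.gradedEnd R := (RG.regular.isGradedSub_eComp e).toSubmodule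
  have h1 : RG.one e ∈ E := mem_eComp
    ((congrArg G.tgt he).symm.trans ((G.tgt_src e).trans he)) (RG.one_mem e he)
  have hspan : E = Submodule.span RG.regular.gradedEnd {RG.one e} := by
    refine le_antisymm (fun x hx => ?_) (Submodule.span_le.2 (Set.singleton_subset_iff.2 h1))
    rw [← one_mul_of_mem_eComp hx]
    exact (isGradedSub_toAddSubgroup (Submodule.span RG.regular.gradedEnd {RG.one e})).1 _
      (Submodule.mem_span_singleton_self _) x
  have : Module.Finite RG.regular.gradedEnd E :=
    Module.Finite.of_fg (hspan ▸ Submodule.fg_span_singleton _)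
  let g : ℕ →o (Submodule RG.regular.gradedEnd E)ᵒᵈ :=
    ⟨fun n => OrderDual.toDual ((hf n).1.toSubmodule.comap E.subtype),
      monotone_nat_of_le_succ fun n x hx => hanti n hx⟩
  obtain ⟨n, hn⟩ := IsArtinian.monotone_stabilizes g
  refine ⟨n, fun k hk => ?_⟩
  have hx : ∀ x : E, x.1 ∈ f n ↔ x.1 ∈ f k := fun x =>
    SetLike.ext_iff.1 (OrderDual.toDual.injective (hn k hk)) x
  ext x
  exact ⟨fun h => (hx ⟨x, (hf k).2 h⟩).2 h, fun h => (hx ⟨x, (hf n).2 h⟩).1 h⟩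

theorem subringRightGamma0Artinian_isoComponent (hss : RG.IsRightGrSemisimple)
    {S : BMod.{u, v, v} RG} (hS : S.str.IsGrSimple) :
    RG.SubringRightGamma0Artinian (RG.isoComponent S) := fun e he f hf hanti =>
  isRightGamma0Artinian hss e he f (fun n => ⟨⟨fun x hx => mul_mem_of_isoComponent hss hS
    ((hf n).1 hx).1 ((hf n).2.1 x hx), (hf n).2.2⟩, fun _ hx => ((hf n).1 hx).2⟩) hanti

/-- Every graded right ideal contained in `1_e R` contains a left identity for itself. -/
theorem exists_mul_eq_self (hss : RG.IsRightGrSemisimple) {N : AddSubgroup R}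
    (hN : RG.regular.IsGradedSub N) (e : Γ) :
    ∃ f ∈ N, ∀ x ∈ N, x ∈ RG.regular.eComp e → f * x = x := by
  obtain ⟨C, hC, hinf, hsup⟩ := IsGrSemisimple.exists_complement hss hN
  obtain ⟨f, hf, c, hc, hfc⟩ := AddSubgroup.mem_sup.1
    (hsup ▸ AddSubgroup.mem_top (RG.one e) : RG.one e ∈ N ⊔ C)
  refine ⟨f, hf, fun x hx hxe => ?_⟩
  have h : f * x + c * x = x := by rw [← add_mul, hfc, one_mul_of_mem_eComp hxe]
  have hcx : c * x ∈ N ⊓ C := ⟨by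
    rw [← sub_eq_of_eq_add' h.symm]
    exact N.sub_mem hx (hN.1 f hf x), hC.1 c hc x⟩
  rw [hinf, AddSubgroup.mem_bot] at hcx
  rwa [hcx, add_zero] at h

theorem le_of_shiftIso (hss : RG.IsRightGrSemisimple) {N N' P : AddSubgroup R}
    (hN : RG.regular.IsGrSimpleSub N) (hN' : RG.regular.IsGrSimpleSub N')
    (h : ShiftIso (RG.regular.sub hN.1) (RG.regular.sub hN'.1)) (hP : RG.IsGradedIdeal P)
    (hle : N ≤ P) : N' ≤ P := by
  obtain ⟨γ, n, hn, hn0⟩ := hN.sub.exists_homogeneous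
  obtain ⟨f, hf, hfn⟩ := exists_mul_eq_self hss hN.1 (G.tgt γ)
  obtain ⟨σ, ψ, hlin, -⟩ := h
  have e : (ψ n : R) = (ψ ⟨f, hf⟩ : R) * (n : R) := by
    have := congrArg Subtype.val (hlin ⟨f, hf⟩ (n : R))
    rw [show (RG.regular.sub hN.1).smul ⟨f, hf⟩ (n : R) = n from
      Subtype.ext (hfn n n.2 (mem_eComp rfl hn))] at this
    exact this
  refine hN'.le_of_mem (P := P) ⟨fun x hx r => (hP.1 x hx r).1, hP.2⟩ (ψ n).2 ?_
    fun h0 => hn0 (ψ.map_eq_zero_iff.1 (Subtype.ext h0))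
  rw [e]
  exact (hP.1 n (hle n.2) _).2

theorem subringGrSimple_isoComponent (hss : RG.IsRightGrSemisimple)
    {S : BMod.{u, v, v} RG} (hS : S.str.IsGrSimple) :
    RG.SubringGrSimple (RG.isoComponent S) := by
  refine ⟨isoComponent_ne_bot hss hS, fun P ⟨hle, hmul, hgr⟩ => or_iff_not_imp_left.2 fun h0 => ?_⟩
  have hP : RG.IsGradedIdeal P := ⟨fun x hx r =>
    ⟨mul_mem_of_isoComponent hss hS (hle hx) (fun y hy => (hmul x hx y hy).1) r,
      mul_mem_of_isoComponent' hss hS (hle hx) (fun y hy => (hmul x hx y hy).2) r⟩, hgr⟩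
  obtain ⟨N, hNP, hN⟩ := IsGrSemisimple.exists_simple_le hss
    (⟨fun x hx r => (hP.1 x hx r).1, hP.2⟩ : RG.regular.IsGradedSub P) h0
  have hSN : ShiftIso S.str (RG.regular.sub hN.1) := by
    by_contra h
    refine hN.2.1 (eq_bot_iff.2 ((le_inf (hNP.trans hle) fun x hx => ?_).trans
      (isoComponent_inf_iSup hss hS).le))
    exact AddSubgroup.mem_iSup_of_mem (bmod hN.1) (AddSubgroup.mem_iSup_of_mem ⟨hN.sub, h⟩
      (mem_isoComponent hN (shiftIso_refl hN.sub) hx))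
  refine le_antisymm hle (isoComponent_le fun N' hN' h => ?_)
  exact le_of_shiftIso hss hN hN' ((h.trans hN'.sub hN.sub hSN).symm hN'.sub hN.sub) hP hNP

end GammaRing


/-- decomposition of a gr-semisimple ring into isoshiftical
components.  Let `R` be a right gr-semisimple object unital `Γ`-graded ring.
For every gr-simple graded right `R`-module `S`, let `R_S` be the isoshiftical
component of `R` of the type of `S`.  Then:
(1) each `R_S` is a nonzero graded ideal of `R`;
(2) the components form a summable family and `R` is the graded direct product
    (equivalently, the internal direct sum) of the components, one for each
    isoshift class of gr-simple `R`-modules;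
(3) each `R_S` is a gr-simple right `Γ₀`-artinian graded ring. -/
theorem isoshiftical_components_of_grSemisimple_ring
    {Γ : Type u} (G : Gpd Γ) {R : Type v} [NonUnitalRing R] (RG : GammaRing G R)
    (hss : RG.IsRightGrSemisimple) :
    -- (1)
    (∀ S : BMod.{u, v, v} RG, S.str.IsGrSimple →
        RG.isoComponent S ≠ ⊥ ∧ RG.IsGradedIdeal (RG.isoComponent S)) ∧
    -- (2): R = ∏^gr_{j ∈ 𝒮(R)} R_j, the family being summable
    ((⨆ (S : BMod.{u, v, v} RG) (_ : S.str.IsGrSimple), RG.isoComponent S) = ⊤ ∧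
      (∀ S : BMod.{u, v, v} RG, S.str.IsGrSimple →
        RG.isoComponent S ⊓
          (⨆ (T : BMod.{u, v, v} RG) (_ : T.str.IsGrSimple ∧ ¬ BModSameClass S T),
            RG.isoComponent T) = ⊥) ∧
      (∀ e : Γ, G.IsObj e → ∃ (n : ℕ) (T : Fin n → BMod.{u, v, v} RG),
        ∀ S : BMod.{u, v, v} RG, S.str.IsGrSimple →
          RG.grade e ⊓ RG.isoComponent S ≠ ⊥ → ∃ i, BModSameClass S (T i))) ∧
    -- (3)
    (∀ S : BMod.{u, v, v} RG, S.str.IsGrSimple →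
        RG.SubringGrSimple (RG.isoComponent S) ∧
        RG.SubringRightGamma0Artinian (RG.isoComponent S)) := by
  simp only [bmodSameClass_iff]
  refine ⟨fun S hS => ⟨GammaRing.isoComponent_ne_bot hss hS,
      GammaRing.isGradedIdeal_isoComponent hss hS⟩,
    ⟨GammaRing.iSup_isoComponent hss, fun S hS => GammaRing.isoComponent_inf_iSup hss hS,
      fun e he => ?_⟩,
    fun S hS => ⟨GammaRing.subringGrSimple_isoComponent hss hS,
      GammaRing.subringRightGamma0Artinian_isoComponent hss hS⟩⟩
  obtain ⟨l, hl⟩ := GammaRing.exists_list_shiftIso hss (RG.one e)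
  refine ⟨l.length, l.get, fun S hS hne => ?_⟩
  obtain ⟨z, hz, hz0⟩ := (AddSubgroup.bot_or_exists_ne_zero _).resolve_left hne
  have htgt : G.tgt e = e := (congrArg G.tgt he).symm.trans ((G.tgt_src e).trans he)
  have h1 : RG.one e * z = z := by
    have := RG.one_mul' e z hz.1
    rwa [htgt] at this
  obtain ⟨T, hT, hST⟩ := hl S hS z hz.2 (by rwa [h1])
  obtain ⟨i, rfl⟩ := List.get_of_mem hT
  exact ⟨i, hST⟩
end
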